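/- Let f : ℝⁿ → [0,1] be Borel measurable with 0 < ∫ f dγₙ < 1, and for s > 0 write f_s = Q_s f. Define ψ(s) = ∫_{ℝⁿ} √(I_γ(f_s)² + |∇f_s|²) dγₙ for s > 0. Then ψ is differentiable on (0, ∞) and for every s > 0, −ψ'(s) ≥ ∫_{ℝⁿ} I_γ(f_s) · ‖Hess(Φ⁻¹ ∘ f_s)‖²_{HS} · (1 + |∇(Φ⁻¹ ∘ f_s)|²)^{−3/2} dγₙ, where ‖·‖_{HS} is the Hilbert–Schmidt norm of the Hessian matrix. -/

import Mathlib

open MeasureTheory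

/-- Standard Gaussian density `φ` on `ℝ`. -/
noncomputable def gaussPdf (x : ℝ) : ℝ := (Real.sqrt (2 * Real.pi))⁻¹ * Real.exp (-(x ^ 2) / 2)

/-- Standard Gaussian cumulative distribution function `Φ`. -/
noncomputable def gaussCdf (x : ℝ) : ℝ := ∫ t in Set.Iic x, gaussPdf t

/-- Inverse of the Gaussian cdf (quantile function `Φ⁻¹`). -/
noncomputable def gaussQuantile : ℝ → ℝ := Function.invFun gaussCdf

/-- Gaussian isoperimetric profile `I_γ`: `I_γ(v) = φ(Φ⁻¹(v))` on `(0,1)`, `0` at the endpoints. -/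
noncomputable def Igauss (v : ℝ) : ℝ :=
  if v = 0 ∨ v = 1 then 0 else gaussPdf (gaussQuantile v)

abbrev En (n : ℕ) := EuclideanSpace ℝ (Fin n)

/-- Standard Gaussian probability measure `γₙ` on `ℝⁿ`. -/
noncomputable def gaussE (n : ℕ) : Measure (En n) :=
  volume.withDensity (fun x =>
    ENNReal.ofReal ((2 * Real.pi) ^ (-(n : ℝ) / 2) * Real.exp (-‖x‖ ^ 2 / 2)))

/-- Ornstein–Uhlenbeck semigroup `Q_t`. -/
noncomputable def ou (n : ℕ) (t : ℝ) (f : En n → ℝ) (x : En n) : ℝ :=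
  ∫ y, f (Real.exp (-t) • x + Real.sqrt (1 - Real.exp (-2 * t)) • y) ∂(gaussE n)

/-- Squared Hilbert–Schmidt norm of the Hessian of `f` at `x`. -/
noncomputable def hessHS2 (n : ℕ) (f : En n → ℝ) (x : En n) : ℝ :=
  ∑ i : Fin n, ∑ j : Fin n,
    (iteratedFDeriv ℝ 2 f x ![EuclideanSpace.single i 1, EuclideanSpace.single j 1]) ^ 2

section OneDimensional

open Filter Topology

lemma gaussPdf_eq_gaussianPDFReal : gaussPdf = ProbabilityTheory.gaussianPDFReal 0 1 := by
  ext x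
  simp [gaussPdf, ProbabilityTheory.gaussianPDFReal]

lemma gaussPdf_pos (x : ℝ) : 0 < gaussPdf x := by
  unfold gaussPdf
  positivity

lemma contDiff_gaussPdf {k : WithTop ℕ∞} : ContDiff ℝ k gaussPdf := by
  unfold gaussPdf
  fun_prop

lemma hasDerivAt_gaussPdf (x : ℝ) : HasDerivAt gaussPdf (-x * gaussPdf x) x := by
  have h : HasDerivAt (fun x : ℝ => -(x ^ 2) / 2) (-x) x := by
    have := ((hasDerivAt_pow 2 x).neg).div_const 2
    convert! this using 1
    push_cast
    ring
  convert! (h.exp).const_mul (Real.sqrt (2 * Real.pi))⁻¹ using 1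
  unfold gaussPdf
  ring

lemma integrable_gaussPdf : Integrable gaussPdf := by
  rw [gaussPdf_eq_gaussianPDFReal]
  exact ProbabilityTheory.integrable_gaussianPDFReal 0 1

lemma integral_gaussPdf : ∫ x, gaussPdf x = 1 := by
  rw [gaussPdf_eq_gaussianPDFReal]
  exact ProbabilityTheory.integral_gaussianPDFReal_eq_one 0 one_ne_zero

lemma hasDerivAt_gaussCdf (x : ℝ) : HasDerivAt gaussCdf (gaussPdf x) x := by
  have hc : Continuous gaussPdf := contDiff_gaussPdf (k := 0).continuous
  have h : gaussCdf = fun x => gaussCdf 0 + ∫ t in (0 : ℝ)..x, gaussPdf t := by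
    ext y
    rw [gaussCdf, gaussCdf, ← intervalIntegral.integral_Iic_sub_Iic
      integrable_gaussPdf.integrableOn integrable_gaussPdf.integrableOn]
    ring
  rw [h]
  exact (intervalIntegral.integral_hasDerivAt_right (hc.intervalIntegrable _ _)
    (hc.stronglyMeasurableAtFilter _ _) hc.continuousAt).const_add _

lemma contDiff_gaussCdf {k : ℕ} : ContDiff ℝ k gaussCdf := by
  have hd : deriv gaussCdf = gaussPdf := funext fun x => (hasDerivAt_gaussCdf x).deriv
  refine ContDiff.of_le (n := (k + 1 : ℕ)) ?_ (by exact_mod_cast Nat.le_succ k)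
  rw [Nat.cast_add, Nat.cast_one, contDiff_succ_iff_deriv]
  exact ⟨fun x => (hasDerivAt_gaussCdf x).differentiableAt, by simp, hd ▸ contDiff_gaussPdf⟩

lemma strictMono_gaussCdf : StrictMono gaussCdf :=
  strictMono_of_hasDerivAt_pos hasDerivAt_gaussCdf gaussPdf_pos

lemma gaussCdf_add_gaussCdf_neg (x : ℝ) : gaussCdf x + gaussCdf (-x) = 1 := by
  have h := integral_add_compl (measurableSet_Iic (a := x)) integrable_gaussPdf
  rw [Set.compl_Iic, integral_gaussPdf] at h
  have h2 := integral_comp_neg_Iic (-x) gaussPdf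
  rw [neg_neg] at h2
  rw [gaussCdf, gaussCdf, ← h, ← h2]
  simp [gaussPdf]

lemma gaussCdf_neg_le_exp {t : ℝ} (ht : 0 ≤ t) : gaussCdf (-t) ≤ Real.exp (-(t ^ 2) / 2) := by
  have hi : Integrable fun x => Real.exp (-(t ^ 2) / 2) * gaussPdf (x + t) :=
    (integrable_gaussPdf.comp_add_right t).const_mul _
  calc gaussCdf (-t) ≤ ∫ x in Set.Iic (-t), Real.exp (-(t ^ 2) / 2) * gaussPdf (x + t) := by
        refine setIntegral_mono_on integrable_gaussPdf.integrableOn hi.integrableOn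
          measurableSet_Iic fun x hx => ?_
        have hx : x ≤ -t := hx
        unfold gaussPdf
        rw [mul_left_comm, ← Real.exp_add]
        gcongr
        nlinarith
    _ ≤ ∫ x, Real.exp (-(t ^ 2) / 2) * gaussPdf (x + t) :=
        setIntegral_le_integral hi (ae_of_all _ fun x => by
          have := gaussPdf_pos (x + t)
          positivity)
    _ = Real.exp (-(t ^ 2) / 2) := by
        rw [integral_const_mul, integral_add_right_eq_self gaussPdf t, integral_gaussPdf, mul_one]

lemma exists_gaussCdf_eq {v : ℝ} (hv : v ∈ Set.Ioo (0 : ℝ) 1) : ∃ q, gaussCdf q = v := by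
  have hlim : Tendsto (fun t : ℝ => Real.exp (-(t ^ 2) / 2)) atTop (𝓝 0) := by
    refine Real.tendsto_exp_atBot.comp ?_
    refine Tendsto.atBot_div_const two_pos (tendsto_neg_atTop_atBot.comp ?_)
    exact tendsto_pow_atTop two_ne_zero
  have hmin : 0 < min v (1 - v) := lt_min hv.1 (by linarith [hv.2])
  obtain ⟨t, ht, ht0⟩ := ((hlim.eventually_lt_const hmin).and (eventually_ge_atTop 0)).exists
  have h1 := gaussCdf_neg_le_exp ht0
  have h2 := gaussCdf_add_gaussCdf_neg t
  have h3 := min_le_left v (1 - v)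
  have h4 := min_le_right v (1 - v)
  exact mem_range_of_exists_le_of_exists_ge (contDiff_gaussCdf (k := 0)).continuous
    ⟨-t, by linarith⟩ ⟨t, by linarith⟩

lemma gaussCdf_gaussQuantile {v : ℝ} (hv : v ∈ Set.Ioo (0 : ℝ) 1) :
    gaussCdf (gaussQuantile v) = v :=
  Function.invFun_eq (exists_gaussCdf_eq hv)

lemma gaussQuantile_gaussCdf (x : ℝ) : gaussQuantile (gaussCdf x) = x :=
  Function.leftInverse_invFun strictMono_gaussCdf.injective x

lemma Igauss_eq {v : ℝ} (hv : v ∈ Set.Ioo (0 : ℝ) 1) :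
    Igauss v = gaussPdf (gaussQuantile v) :=
  if_neg (by rintro (h | h) <;> simp [h] at hv)

lemma hasDerivAt_gaussQuantile {v : ℝ} (hv : v ∈ Set.Ioo (0 : ℝ) 1) :
    HasDerivAt gaussQuantile (gaussPdf (gaussQuantile v))⁻¹ v := by
  have h : HasStrictDerivAt gaussCdf (gaussPdf (gaussQuantile v)) (gaussQuantile v) :=
    (contDiff_gaussCdf (k := 1)).contDiffAt.hasStrictDerivAt' (hasDerivAt_gaussCdf _)
      (by norm_num)
  have := (h.to_local_left_inverse (gaussPdf_pos _).ne'
    (Eventually.of_forall gaussQuantile_gaussCdf)).hasDerivAt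
  rwa [gaussCdf_gaussQuantile hv] at this

lemma contDiffOn_gaussQuantile (k : ℕ) : ContDiffOn ℝ k gaussQuantile (Set.Ioo 0 1) := by
  induction k with
  | zero =>
    exact contDiffOn_zero.2 fun v hv =>
      (hasDerivAt_gaussQuantile hv).continuousAt.continuousWithinAt
  | succ k ih =>
    rw [Nat.cast_add, Nat.cast_one, contDiffOn_succ_iff_deriv_of_isOpen isOpen_Ioo]
    refine ⟨fun v hv => (hasDerivAt_gaussQuantile hv).differentiableAt.differentiableWithinAt,
      by simp, ContDiffOn.congr ?_ fun v hv => (hasDerivAt_gaussQuantile hv).deriv⟩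
    exact (contDiff_gaussPdf.comp_contDiffOn ih).inv fun v _ => (gaussPdf_pos _).ne'

lemma hasDerivAt_Igauss {v : ℝ} (hv : v ∈ Set.Ioo (0 : ℝ) 1) :
    HasDerivAt Igauss (-gaussQuantile v) v := by
  have h := (hasDerivAt_gaussPdf (gaussQuantile v)).comp v (hasDerivAt_gaussQuantile hv)
  rw [mul_assoc, mul_inv_cancel₀ (gaussPdf_pos _).ne', mul_one] at h
  exact h.congr_of_eventuallyEq
    (eventually_of_mem (isOpen_Ioo.mem_nhds hv) fun w hw => Igauss_eq hw)

/-- Gaussian lower bounds on `v` and `1 - v` bound the quantile of `v`. -/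
lemma abs_gaussQuantile_le {v r : ℝ} (hr : 0 ≤ r) (hv : v ∈ Set.Ioo (0 : ℝ) 1)
    (h0 : Real.exp (-(r ^ 2) / 2) ≤ v) (h1 : Real.exp (-(r ^ 2) / 2) ≤ 1 - v) :
    |gaussQuantile v| ≤ r := by
  have hsym := gaussCdf_add_gaussCdf_neg r
  have hneg := gaussCdf_neg_le_exp hr
  rw [abs_le]
  constructor
  · rw [← strictMono_gaussCdf.le_iff_le, gaussCdf_gaussQuantile hv]
    linarith
  · rw [← strictMono_gaussCdf.le_iff_le, gaussCdf_gaussQuantile hv]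
    linarith

end OneDimensional

section PolynomialGrowth

variable {n : ℕ}

/-- Polynomial growth in space, uniformly over the times in `S`. -/
def PolyBdd (S : Set ℝ) (w : ℝ → En n → ℝ) : Prop :=
  ∃ (C : ℝ) (k : ℕ), ∀ s ∈ S, ∀ x, |w s x| ≤ C * (1 + ‖x‖) ^ k

namespace PolyBdd

variable {S : Set ℝ} {v w : ℝ → En n → ℝ}

lemma mono {T : Set ℝ} (h : PolyBdd S w) (hT : T ⊆ S) : PolyBdd T w :=
  let ⟨C, k, h⟩ := h
  ⟨C, k, fun s hs => h s (hT hs)⟩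

lemma of_abs_le (h : PolyBdd S w) (hvw : ∀ s ∈ S, ∀ x, |v s x| ≤ |w s x|) : PolyBdd S v :=
  let ⟨C, k, h⟩ := h
  ⟨C, k, fun s hs x => (hvw s hs x).trans (h s hs x)⟩

lemma exists_nonneg (h : PolyBdd S w) :
    ∃ (C : ℝ) (k : ℕ), 0 ≤ C ∧ ∀ s ∈ S, ∀ x, |w s x| ≤ C * (1 + ‖x‖) ^ k := by
  obtain ⟨C, k, h⟩ := h
  refine ⟨|C|, k, abs_nonneg C, fun s hs x => (h s hs x).trans ?_⟩
  gcongr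
  exact le_abs_self C

lemma time {c : ℝ → ℝ} {K : ℝ} (h : ∀ s ∈ S, |c s| ≤ K) : PolyBdd (n := n) S fun s _ => c s :=
  ⟨K, 0, fun s hs _ => by simpa using h s hs⟩

lemma const (c : ℝ) : PolyBdd (n := n) S fun _ _ => c :=
  time fun _ _ => le_rfl

lemma norm : PolyBdd (n := n) S fun _ x => ‖x‖ :=
  ⟨1, 1, fun _ _ x => by rw [abs_norm]; linarith⟩

lemma coord (i : Fin n) : PolyBdd S fun _ x => x i :=
  norm.of_abs_le fun _ _ x => by simpa using PiLp.norm_apply_le x i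

lemma mul (hv : PolyBdd S v) (hw : PolyBdd S w) : PolyBdd S fun s x => v s x * w s x := by
  obtain ⟨C, k, hC, hv⟩ := hv.exists_nonneg
  obtain ⟨D, l, hD, hw⟩ := hw.exists_nonneg
  refine ⟨C * D, k + l, fun s hs x => ?_⟩
  calc |v s x * w s x| = |v s x| * |w s x| := abs_mul _ _
    _ ≤ (C * (1 + ‖x‖) ^ k) * (D * (1 + ‖x‖) ^ l) := by
        gcongr
        exacts [hv s hs x, hw s hs x]
    _ = _ := by ring

lemma add (hv : PolyBdd S v) (hw : PolyBdd S w) : PolyBdd S fun s x => v s x + w s x := by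
  obtain ⟨C, k, hC, hv⟩ := hv.exists_nonneg
  obtain ⟨D, l, hD, hw⟩ := hw.exists_nonneg
  refine ⟨C + D, k + l, fun s hs x => ?_⟩
  have h1 : (1 : ℝ) ≤ 1 + ‖x‖ := by linarith [norm_nonneg x]
  calc |v s x + w s x| ≤ |v s x| + |w s x| := abs_add_le _ _
    _ ≤ C * (1 + ‖x‖) ^ k + D * (1 + ‖x‖) ^ l := add_le_add (hv s hs x) (hw s hs x)
    _ ≤ C * (1 + ‖x‖) ^ (k + l) + D * (1 + ‖x‖) ^ (k + l) := by
        gcongr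
        all_goals first | exact h1 | omega
    _ = _ := by ring

lemma neg (hw : PolyBdd S w) : PolyBdd S fun s x => -w s x :=
  hw.of_abs_le fun _ _ _ => (abs_neg _).le

lemma sub (hv : PolyBdd S v) (hw : PolyBdd S w) : PolyBdd S fun s x => v s x - w s x := by
  simpa only [sub_eq_add_neg] using hv.add hw.neg

lemma sum {ι : Type*} {t : Finset ι} {w : ι → ℝ → En n → ℝ} (h : ∀ i ∈ t, PolyBdd S (w i)) :
    PolyBdd S fun s x => ∑ i ∈ t, w i s x := by
  classical
  induction t using Finset.induction_on with
  | empty => simpa using const (n := n) (S := S) 0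
  | insert i t hi ih =>
    simp only [Finset.sum_insert hi]
    exact (h i (Finset.mem_insert_self i t)).add
      (ih fun j hj => h j (Finset.mem_insert_of_mem hj))

end PolyBdd

/-- Measurable functions of polynomial growth. -/
structure TemperedFun (g : En n → ℝ) : Prop where
  measurable : Measurable g
  polyBdd : PolyBdd Set.univ fun _ => g

namespace TemperedFun

variable {g : En n → ℝ}

lemma coord_mul (hg : TemperedFun g) (i : Fin n) : TemperedFun fun z => z i * g z :=
  ⟨Measurable.mul (by fun_prop) hg.measurable, (PolyBdd.coord i).mul hg.polyBdd⟩

lemma norm_sq_mul (hg : TemperedFun g) : TemperedFun fun z => ‖z‖ ^ 2 * g z := by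
  refine ⟨Measurable.mul (by fun_prop) hg.measurable, ?_⟩
  simpa only [sq] using (PolyBdd.norm.mul PolyBdd.norm).mul hg.polyBdd

lemma of_mem_Icc (hg : Measurable g) (h : ∀ x, g x ∈ Set.Icc (0 : ℝ) 1) : TemperedFun g :=
  ⟨hg, 1, 0, fun _ _ x => by simpa [abs_of_nonneg (h x).1] using (h x).2⟩

end TemperedFun

lemma exists_pow_mul_exp_le (k : ℕ) {δ : ℝ} (hδ : 0 < δ) :
    ∃ C : ℝ, 0 ≤ C ∧ ∀ r : ℝ, 0 ≤ r → (1 + r) ^ k * Real.exp (-δ * r ^ 2) ≤ C := by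
  refine ⟨k.factorial * Real.exp (1 + 1 / (4 * δ)), by positivity, fun r hr => ?_⟩
  have h1 : (1 + r) ^ k ≤ k.factorial * Real.exp (1 + r) := by
    have := Real.pow_div_factorial_le_exp (1 + r) (by linarith) k
    rwa [div_le_iff₀' (by positivity)] at this
  calc (1 + r) ^ k * Real.exp (-δ * r ^ 2)
      ≤ k.factorial * Real.exp (1 + r) * Real.exp (-δ * r ^ 2) := by gcongr
    _ = k.factorial * Real.exp (1 + r + -δ * r ^ 2) := by rw [mul_assoc, ← Real.exp_add]
    _ ≤ _ := by
        refine mul_le_mul_of_nonneg_left (Real.exp_le_exp.2 ?_) (by positivity)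
        have h2 : 0 ≤ (2 * δ * r - 1) ^ 2 / (4 * δ) := by positivity
        have h3 : (2 * δ * r - 1) ^ 2 / (4 * δ) = δ * r ^ 2 - r + 1 / (4 * δ) := by
          field_simp
          ring
        linarith

lemma integrable_exp_neg_mul_norm_sq {α : ℝ} (hα : 0 < α) :
    Integrable fun z : En n => Real.exp (-α * ‖z‖ ^ 2) := by
  by_contra h
  have h1 := GaussianFourier.integral_rexp_neg_mul_sq_norm (V := En n) hα
  rw [integral_undef h] at h1
  exact (Real.rpow_pos_of_pos (by positivity) _).ne h1

lemma TemperedFun.integrable_exp_mul {g : En n → ℝ} (hg : TemperedFun g) {α : ℝ} (hα : 0 < α) :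
    Integrable fun z : En n => Real.exp (-α * ‖z‖ ^ 2) * g z := by
  obtain ⟨C, k, hC, h⟩ := hg.polyBdd.exists_nonneg
  obtain ⟨D, hD, hk⟩ := exists_pow_mul_exp_le k (half_pos hα)
  refine ((integrable_exp_neg_mul_norm_sq (n := n) (half_pos hα)).const_mul (C * D)).mono'
    (Measurable.aestronglyMeasurable (Measurable.mul (by fun_prop) hg.measurable))
    (ae_of_all _ fun z => ?_)
  have h1 : Real.exp (-α * ‖z‖ ^ 2)
      = Real.exp (-(α / 2) * ‖z‖ ^ 2) * Real.exp (-(α / 2) * ‖z‖ ^ 2) := by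
    rw [← Real.exp_add]
    ring_nf
  rw [Real.norm_eq_abs, abs_mul, Real.abs_exp, h1]
  calc _ ≤ Real.exp (-(α / 2) * ‖z‖ ^ 2) * Real.exp (-(α / 2) * ‖z‖ ^ 2)
          * (C * (1 + ‖z‖) ^ k) := by
        gcongr
        exact h 0 trivial z
    _ = C * ((1 + ‖z‖) ^ k * Real.exp (-(α / 2) * ‖z‖ ^ 2)) * Real.exp (-(α / 2) * ‖z‖ ^ 2) := by
        ring
    _ ≤ _ := by
        gcongr
        exact hk _ (norm_nonneg z)

end PolynomialGrowth

section GaussianMeasure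

variable {n : ℕ}

/-- Density of `gaussE n` with respect to Lebesgue measure. -/
noncomputable def gaussDens (x : En n) : ℝ :=
  (2 * Real.pi) ^ (-(n : ℝ) / 2) * Real.exp (-‖x‖ ^ 2 / 2)

lemma gaussDens_pos (x : En n) : 0 < gaussDens x := by
  unfold gaussDens
  positivity

lemma continuous_gaussDens : Continuous (gaussDens (n := n)) := by
  unfold gaussDens
  fun_prop

lemma gaussDens_eq (x : En n) :
    gaussDens x = (2 * Real.pi) ^ (-(n : ℝ) / 2) * Real.exp (-(1 / 2) * ‖x‖ ^ 2) := by
  rw [gaussDens]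
  ring_nf

lemma integral_gaussE (g : En n → ℝ) : ∫ x, g x ∂(gaussE n) = ∫ x, gaussDens x * g x := by
  have hm : Measurable fun x : En n => (gaussDens x).toNNReal :=
    continuous_gaussDens.measurable.real_toNNReal
  have := integral_withDensity_eq_integral_smul (μ := volume) hm g
  convert! this using 2
  ext x
  rw [NNReal.smul_def, Real.coe_toNNReal _ (gaussDens_pos x).le, smul_eq_mul]

lemma integrable_gaussE_iff (g : En n → ℝ) :
    Integrable g (gaussE n) ↔ Integrable fun x => gaussDens x * g x := by
  have hm : Measurable fun x : En n => (gaussDens x).toNNReal :=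
    continuous_gaussDens.measurable.real_toNNReal
  have := integrable_withDensity_iff_integrable_smul (μ := volume) hm (g := g)
  convert! this using 2
  ext x
  rw [NNReal.smul_def, Real.coe_toNNReal _ (gaussDens_pos x).le, smul_eq_mul]

lemma TemperedFun.integrable_gaussE {g : En n → ℝ} (hg : TemperedFun g) :
    Integrable g (gaussE n) := by
  rw [integrable_gaussE_iff]
  simp only [gaussDens_eq, mul_assoc]
  exact (hg.integrable_exp_mul one_half_pos).const_mul _

lemma integral_gaussDens : ∫ x : En n, gaussDens x = 1 := by
  simp only [gaussDens_eq]
  rw [integral_const_mul, GaussianFourier.integral_rexp_neg_mul_sq_norm one_half_pos,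
    finrank_euclideanSpace_fin, div_div_eq_mul_div, div_one, mul_comm Real.pi,
    ← Real.rpow_add (by positivity)]
  rw [neg_div, neg_add_cancel, Real.rpow_zero]

instance : IsProbabilityMeasure (gaussE n) where
  measure_univ := by
    have hi : Integrable (gaussDens (n := n)) := by
      have := (integrable_gaussE_iff (n := n) fun _ => 1).1 (TemperedFun.integrable_gaussE
        ⟨measurable_const, PolyBdd.const 1⟩)
      simpa using this
    rw [gaussE, withDensity_apply _ MeasurableSet.univ, Measure.restrict_univ]
    change ∫⁻ x, ENNReal.ofReal (gaussDens x) = 1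
    rw [← ofReal_integral_eq_lintegral_ofReal hi (ae_of_all _ fun x => (gaussDens_pos x).le),
      integral_gaussDens, ENNReal.ofReal_one]

end GaussianMeasure

section ExponentialTilt

variable {n : ℕ}

open Filter Topology

/-- Exponent of the Gaussian exponential family with natural parameter `θ`. -/
noncomputable def tiltExp (θ : ℝ × En n) (z : En n) : ℝ :=
  Real.exp (-θ.1 * ‖z‖ ^ 2 + inner ℝ θ.2 z)

/-- Unnormalised integrals against the Gaussian exponential family. -/
noncomputable def tilt (g : En n → ℝ) (θ : ℝ × En n) : ℝ := ∫ z, tiltExp θ z * g z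

lemma measurable_tiltExp (θ : ℝ × En n) : Measurable (tiltExp θ) := by
  unfold tiltExp
  fun_prop

lemma tiltExp_le {α₀ B : ℝ} (hα₀ : 0 < α₀) {θ : ℝ × En n} (h1 : α₀ ≤ θ.1)
    (h2 : ‖θ.2‖ ≤ B) (z : En n) :
    tiltExp θ z ≤ Real.exp (B ^ 2 / (2 * α₀)) * Real.exp (-(α₀ / 2) * ‖z‖ ^ 2) := by
  rw [tiltExp, ← Real.exp_add, Real.exp_le_exp]
  have h3 : inner ℝ θ.2 z ≤ B * ‖z‖ :=
    (real_inner_le_norm _ _).trans (by gcongr)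
  have h4 : 0 ≤ (B - α₀ * ‖z‖) ^ 2 / (2 * α₀) := by positivity
  have h5 : (B - α₀ * ‖z‖) ^ 2 / (2 * α₀)
      = B ^ 2 / (2 * α₀) - B * ‖z‖ + α₀ / 2 * ‖z‖ ^ 2 := by
    field_simp
    ring
  have h6 : α₀ * ‖z‖ ^ 2 ≤ θ.1 * ‖z‖ ^ 2 := by gcongr
  linarith

lemma TemperedFun.integrable_tiltExp_mul {g : En n → ℝ} (hg : TemperedFun g) {θ : ℝ × En n}
    (hθ : 0 < θ.1) : Integrable fun z => tiltExp θ z * g z := by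
  refine ((hg.integrable_exp_mul (half_pos hθ)).norm.const_mul
    (Real.exp (‖θ.2‖ ^ 2 / (2 * θ.1)))).mono'
    ((measurable_tiltExp θ).mul hg.measurable).aestronglyMeasurable (ae_of_all _ fun z => ?_)
  have h : ‖tiltExp θ z‖ ≤
      Real.exp (‖θ.2‖ ^ 2 / (2 * θ.1)) * ‖Real.exp (-(θ.1 / 2) * ‖z‖ ^ 2)‖ := by
    rw [Real.norm_eq_abs, tiltExp, Real.abs_exp, Real.norm_eq_abs, Real.abs_exp]
    exact tiltExp_le hθ le_rfl le_rfl z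
  rw [norm_mul, norm_mul, ← mul_assoc]
  gcongr

/-- The sufficient statistic of the exponential family, as a functional on parameters. -/
noncomputable def tiltStat (z : En n) : ℝ × En n →L[ℝ] ℝ :=
  (-‖z‖ ^ 2) • ContinuousLinearMap.fst ℝ ℝ (En n)
    + (innerSL ℝ z).comp (ContinuousLinearMap.snd ℝ ℝ (En n))

lemma tiltStat_apply (z : En n) (d : ℝ × En n) :
    tiltStat z d = -‖z‖ ^ 2 * d.1 + inner ℝ z d.2 := by
  simp [tiltStat]

lemma continuous_tiltStat : Continuous (tiltStat (n := n)) := by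
  unfold tiltStat
  fun_prop

lemma norm_tiltStat_le (z : En n) : ‖tiltStat z‖ ≤ ‖z‖ ^ 2 + ‖z‖ := by
  refine ContinuousLinearMap.opNorm_le_bound _ (by positivity) fun d => ?_
  rw [tiltStat_apply, add_mul]
  refine (norm_add_le _ _).trans (add_le_add ?_ ?_)
  · rw [norm_mul, norm_neg, norm_pow, norm_norm]
    gcongr
    exact norm_fst_le d
  · refine (norm_inner_le_norm _ _).trans ?_
    gcongr
    exact norm_snd_le d

lemma hasFDerivAt_tiltExp (θ : ℝ × En n) (z : En n) :
    HasFDerivAt (fun θ => tiltExp θ z) (tiltExp θ z • tiltStat z) θ := by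
  have h : HasFDerivAt (fun θ : ℝ × En n => -θ.1 * ‖z‖ ^ 2 + inner ℝ θ.2 z) (tiltStat z) θ := by
    have := (tiltStat z).hasFDerivAt (x := θ)
    convert! this using 2 with d
    rw [tiltStat_apply, real_inner_comm]
    ring
  exact h.exp

lemma TemperedFun.hasFDerivAt_tilt {g : En n → ℝ} (hg : TemperedFun g) {θ₀ : ℝ × En n}
    (hθ₀ : 0 < θ₀.1) :
    HasFDerivAt (tilt g) (∫ z, (tiltExp θ₀ z * g z) • tiltStat z) θ₀ ∧
      Integrable fun z => (tiltExp θ₀ z * g z) • tiltStat z := by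
  set S : Set (ℝ × En n) := {θ | θ₀.1 / 2 < θ.1 ∧ ‖θ.2‖ < ‖θ₀.2‖ + 1} with hS
  have hSo : IsOpen S := by
    refine IsOpen.and ?_ ?_
    · exact isOpen_lt continuous_const continuous_fst
    · exact isOpen_lt continuous_snd.norm continuous_const
  have hmem : θ₀ ∈ S := ⟨half_lt_self hθ₀, lt_add_one _⟩
  set K := Real.exp ((‖θ₀.2‖ + 1) ^ 2 / (2 * (θ₀.1 / 2)))
  set bound : En n → ℝ := fun z =>
    K * (|Real.exp (-(θ₀.1 / 2 / 2) * ‖z‖ ^ 2) * (‖z‖ ^ 2 * g z)|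
      + |Real.exp (-(θ₀.1 / 2 / 2) * ‖z‖ ^ 2) * (‖z‖ * g z)|)
  have hn : TemperedFun fun z => ‖z‖ * g z :=
    ⟨Measurable.mul (by fun_prop) hg.measurable, PolyBdd.norm.mul hg.polyBdd⟩
  have hbound : Integrable bound :=
    ((hg.norm_sq_mul.integrable_exp_mul (by positivity)).abs.add
      (hn.integrable_exp_mul (by positivity)).abs).const_mul K
  have hle : ∀ z, ∀ θ ∈ S, ‖(tiltExp θ z * g z) • tiltStat z‖ ≤ bound z := by
    intro z θ hθ
    rw [norm_smul, norm_mul]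
    have h1 : ‖tiltExp θ z‖ ≤ K * Real.exp (-(θ₀.1 / 2 / 2) * ‖z‖ ^ 2) := by
      rw [Real.norm_eq_abs, tiltExp, Real.abs_exp]
      exact tiltExp_le (half_pos hθ₀) hθ.1.le hθ.2.le z
    calc ‖tiltExp θ z‖ * ‖g z‖ * ‖tiltStat z‖
        ≤ K * Real.exp (-(θ₀.1 / 2 / 2) * ‖z‖ ^ 2) * ‖g z‖ * (‖z‖ ^ 2 + ‖z‖) := by
          gcongr
          exact norm_tiltStat_le z
      _ = bound z := by
          simp only [bound, abs_mul, Real.abs_exp, abs_pow, abs_norm, Real.norm_eq_abs]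
          ring
  have hmeas : AEStronglyMeasurable (fun z => (tiltExp θ₀ z * g z) • tiltStat z) volume :=
    ((measurable_tiltExp θ₀).mul hg.measurable).aestronglyMeasurable.smul
      continuous_tiltStat.aestronglyMeasurable
  refine ⟨?_, hbound.mono' hmeas (ae_of_all _ fun z => hle z θ₀ hmem)⟩
  refine hasFDerivAt_integral_of_dominated_of_fderiv_le (hSo.mem_nhds hmem)
    (Eventually.of_forall fun θ =>
      ((measurable_tiltExp θ).mul hg.measurable).aestronglyMeasurable)
    (hg.integrable_tiltExp_mul hθ₀) hmeas (ae_of_all _ hle) hbound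
    (ae_of_all _ fun z θ _ => ?_)
  convert! (hasFDerivAt_tiltExp θ z).mul_const (g z) using 1
  rw [smul_smul, mul_comm]

/-- Derivative of `tilt g` in terms of tilts of `g` times polynomials. -/
lemma TemperedFun.fderiv_tilt_apply {g : En n → ℝ} (hg : TemperedFun g) {θ : ℝ × En n}
    (hθ : 0 < θ.1) (d : ℝ × En n) :
    fderiv ℝ (tilt g) θ d = -d.1 * tilt (fun z => ‖z‖ ^ 2 * g z) θ
      + ∑ i, d.2 i * tilt (fun z => z i * g z) θ := by
  obtain ⟨h1, h2⟩ := hg.hasFDerivAt_tilt hθ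
  rw [h1.fderiv, ContinuousLinearMap.integral_apply h2]
  simp only [tilt, ← integral_const_mul]
  have hi : ∀ i, Integrable fun z => d.2 i * (tiltExp θ z * (z i * g z)) := fun i =>
    ((hg.coord_mul i).integrable_tiltExp_mul hθ).const_mul _
  rw [← integral_finsetSum _ fun i _ => hi i, ← integral_add
    ((hg.norm_sq_mul.integrable_tiltExp_mul hθ).const_mul _)
    (integrable_finsetSum _ fun i _ => hi i)]
  refine integral_congr_ae (ae_of_all _ fun z => ?_)
  simp only [smul_apply, tiltStat_apply, smul_eq_mul, PiLp.inner_apply,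
    RCLike.inner_apply, conj_trivial, mul_add, Finset.mul_sum]
  congr 1
  · ring
  · exact Finset.sum_congr rfl fun i _ => by ring

end ExponentialTilt

section OrnsteinUhlenbeck

variable {n : ℕ}

open Filter Topology

/-- Variance `1 - exp (-2 * s)` of the Ornstein–Uhlenbeck transition kernel. -/
noncomputable def ouVar (s : ℝ) : ℝ := 1 - Real.exp (-2 * s)

lemma ouVar_pos {s : ℝ} (hs : 0 < s) : 0 < ouVar s := by
  rw [ouVar, sub_pos, Real.exp_lt_one_iff]
  linarith

lemma ouVar_le_one (s : ℝ) : ouVar s ≤ 1 := by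
  rw [ouVar]
  linarith [Real.exp_pos (-2 * s)]

lemma ouVar_mono {s t : ℝ} (h : s ≤ t) : ouVar s ≤ ouVar t := by
  have := Real.exp_le_exp.2 (by linarith : -2 * t ≤ -2 * s)
  unfold ouVar
  linarith

lemma exp_neg_two_mul (s : ℝ) : Real.exp (-2 * s) = Real.exp (-s) ^ 2 := by
  rw [← Real.exp_nat_mul]
  ring_nf

lemma hasDerivAt_exp_neg (s : ℝ) : HasDerivAt (fun s => Real.exp (-s)) (-Real.exp (-s)) s := by
  simpa using (hasDerivAt_neg s).exp

lemma hasDerivAt_ouVar (s : ℝ) : HasDerivAt ouVar (2 * Real.exp (-s) ^ 2) s := by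
  have h : ouVar = fun s => 1 - Real.exp (-s) ^ 2 := funext fun s => by
    rw [ouVar, exp_neg_two_mul]
  rw [h]
  convert! ((hasDerivAt_exp_neg s).pow 2).const_sub 1 using 1
  ring

/-- Normalisation of the Ornstein–Uhlenbeck kernel written as an exponential family. -/
noncomputable def ouNorm (s : ℝ) (x : En n) : ℝ :=
  (2 * Real.pi) ^ (-(n : ℝ) / 2) * (ouVar s) ^ (-(n : ℝ) / 2)
    * Real.exp (-(Real.exp (-s) ^ 2 / ouVar s) * ‖x‖ ^ 2 / 2)

/-- Natural parameter of the Ornstein–Uhlenbeck kernel at time `s` started from `x`. -/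
noncomputable def ouPar (s : ℝ) (x : En n) : ℝ × En n :=
  ((ouVar s)⁻¹ / 2, (Real.exp (-s) / ouVar s) • x)

lemma ouPar_fst_pos {s : ℝ} (hs : 0 < s) (x : En n) : 0 < (ouPar s x).1 :=
  half_pos (inv_pos.2 (ouVar_pos hs))

lemma ou_eq_tilt {s : ℝ} (hs : 0 < s) (g : En n → ℝ) (x : En n) :
    ou n s g x = ouNorm s x * tilt g (ouPar s x) := by
  have hV := ouVar_pos hs
  set σ := Real.sqrt (ouVar s) with hσ
  have hσ0 : 0 < σ := Real.sqrt_pos.2 hV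
  have hσV : σ ^ 2 = ouVar s := Real.sq_sqrt hV.le
  set a := Real.exp (-s) with ha
  let G : En n → ℝ := fun z => gaussDens (σ⁻¹ • (z - a • x)) * g z
  have h1 : ou n s g x = ∫ y, G (a • x + σ • y) := by
    rw [ou, integral_gaussE]
    refine integral_congr_ae (ae_of_all _ fun y => ?_)
    simp only [G, add_sub_cancel_left, inv_smul_smul₀ hσ0.ne']
    rfl
  have h2 : ∫ y, G (a • x + σ • y) = (σ ^ n)⁻¹ * ∫ z, G z := by
    rw [Measure.integral_comp_smul volume (fun y => G (a • x + y)) σ,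
      integral_add_left_eq_self G, finrank_euclideanSpace_fin, smul_eq_mul,
      abs_of_pos (by positivity)]
  have h3 : (σ ^ n)⁻¹ = (ouVar s) ^ (-(n : ℝ) / 2) := by
    rw [hσ, Real.sqrt_eq_rpow, ← Real.rpow_natCast, ← Real.rpow_mul hV.le, ← Real.rpow_neg hV.le]
    ring_nf
  rw [h1, h2, h3, ouNorm, tilt, ← integral_const_mul, ← integral_const_mul]
  refine integral_congr_ae (ae_of_all _ fun z => ?_)
  simp only [G, gaussDens, tiltExp, ouPar]
  have h4 : -‖σ⁻¹ • (z - a • x)‖ ^ 2 / 2 = -(a ^ 2 / ouVar s) * ‖x‖ ^ 2 / 2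
      + (-((ouVar s)⁻¹ / 2) * ‖z‖ ^ 2 + inner ℝ ((a / ouVar s) • x) z) := by
    rw [norm_smul, mul_pow, norm_sub_sq_real, norm_smul, inner_smul_left, inner_smul_right,
      real_inner_comm, norm_inv, inv_pow, Real.norm_eq_abs, Real.norm_eq_abs, sq_abs, hσV, mul_pow,
      sq_abs, conj_trivial]
    field_simp
    ring
  rw [h4, Real.exp_add]
  ring

/-- Partial derivative in the `i`-th coordinate direction. -/
noncomputable def pd (i : Fin n) (w : En n → ℝ) (x : En n) : ℝ :=
  fderiv ℝ w x (EuclideanSpace.single i 1)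

/-- Generator of the Ornstein–Uhlenbeck semigroup. -/
noncomputable def ouGen (w : En n → ℝ) (x : En n) : ℝ :=
  ∑ i, (pd i (pd i w) x - x i * pd i w x)

lemma hasFDerivAt_ouNorm (s : ℝ) (x : En n) :
    HasFDerivAt (ouNorm s) ((-(Real.exp (-s) ^ 2 / ouVar s) * ouNorm s x) • innerSL ℝ x) x := by
  have h := ((((hasStrictFDerivAt_norm_sq x).hasFDerivAt.const_mul
    (-(Real.exp (-s) ^ 2 / ouVar s))).mul_const (2⁻¹ : ℝ)).exp).const_mul
      ((2 * Real.pi) ^ (-(n : ℝ) / 2) * (ouVar s) ^ (-(n : ℝ) / 2))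
  convert! h using 1
  ext v
  simp [ouNorm, div_eq_mul_inv]
  ring

lemma TemperedFun.hasFDerivAt_ou {g : En n → ℝ} (hg : TemperedFun g) {s : ℝ} (hs : 0 < s)
    (x : En n) :
    HasFDerivAt (ou n s g)
      (∑ i, (Real.exp (-s) / ouVar s *
        (ou n s (fun z => z i * g z) x - Real.exp (-s) * x i * ou n s g x)) •
          (EuclideanSpace.proj i : En n →L[ℝ] ℝ)) x := by
  have hV := ouVar_pos hs
  have h0 : ou n s g = fun x => ouNorm s x * tilt g (ouPar s x) := funext (ou_eq_tilt hs g)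
  have hpar : HasFDerivAt (ouPar s)
      ((0 : En n →L[ℝ] ℝ).prod ((Real.exp (-s) / ouVar s) • ContinuousLinearMap.id ℝ (En n))) x :=
    (hasFDerivAt_const _ _).prodMk
      ((Real.exp (-s) / ouVar s) • ContinuousLinearMap.id ℝ (En n)).hasFDerivAt
  have htilt := (hg.hasFDerivAt_tilt (ouPar_fst_pos hs x)).1.differentiableAt.hasFDerivAt.comp
    x hpar
  rw [h0]
  convert! (hasFDerivAt_ouNorm s x).mul htilt using 1
  ext v
  simp only [sum_apply, smul_apply, add_apply,
    ContinuousLinearMap.comp_apply, hg.fderiv_tilt_apply (ouPar_fst_pos hs x), ou_eq_tilt hs,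
    ContinuousLinearMap.prod_apply, smul_eq_mul, innerSL_apply_apply, PiLp.inner_apply,
    PiLp.proj_apply, Function.comp, RCLike.inner_apply, conj_trivial]
  simp only [zero_apply, ContinuousLinearMap.id_apply, PiLp.smul_apply, smul_eq_mul, neg_zero,
    zero_mul, zero_add, Finset.mul_sum]
  rw [← Finset.sum_add_distrib]
  refine Finset.sum_congr rfl fun i _ => ?_
  field_simp
  ring

lemma TemperedFun.pd_ou {g : En n → ℝ} (hg : TemperedFun g) {s : ℝ} (hs : 0 < s) (i : Fin n) :
    pd i (ou n s g) = fun x => Real.exp (-s) / ouVar s *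
      (ou n s (fun z => z i * g z) x - Real.exp (-s) * x i * ou n s g x) := by
  ext x
  rw [pd, (hg.hasFDerivAt_ou hs x).fderiv]
  simp

lemma TemperedFun.contDiff_ou {g : En n → ℝ} (hg : TemperedFun g) {s : ℝ} (hs : 0 < s) (k : ℕ) :
    ContDiff ℝ k (ou n s g) := by
  induction k generalizing g with
  | zero =>
    exact contDiff_zero.2 (continuous_iff_continuousAt.2 fun x =>
      (hg.hasFDerivAt_ou hs x).continuousAt)
  | succ k ih =>
    rw [Nat.cast_add, Nat.cast_one, contDiff_succ_iff_fderiv]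
    refine ⟨fun x => (hg.hasFDerivAt_ou hs x).differentiableAt, by simp, ?_⟩
    rw [funext fun x => (hg.hasFDerivAt_ou hs x).fderiv]
    have h1 := ih hg
    have h2 := fun i => ih (hg.coord_mul i)
    refine ContDiff.sum fun i _ => ?_
    have := h2 i
    fun_prop

/-- Explicit time derivative of `s ↦ ou n s g x`. -/
noncomputable def ouDt (g : En n → ℝ) (s : ℝ) (x : En n) : ℝ :=
  (-n * (Real.exp (-s) ^ 2 / ouVar s) + (Real.exp (-s) ^ 2 / ouVar s) * ‖x‖ ^ 2
      + (Real.exp (-s) ^ 2 / ouVar s) ^ 2 * ‖x‖ ^ 2) * ou n s g x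
    + (Real.exp (-s) / ouVar s) ^ 2 * ou n s (fun z => ‖z‖ ^ 2 * g z) x
    - (Real.exp (-s) / ouVar s) * (1 + 2 * (Real.exp (-s) ^ 2 / ouVar s))
      * ∑ i, x i * ou n s (fun z => z i * g z) x

lemma hasDerivAt_ouNorm {s : ℝ} (hs : 0 < s) (x : En n) :
    HasDerivAt (fun s => ouNorm s x) ((-n * (Real.exp (-s) ^ 2 / ouVar s)
      + (Real.exp (-s) ^ 2 / ouVar s) * ‖x‖ ^ 2
      + (Real.exp (-s) ^ 2 / ouVar s) ^ 2 * ‖x‖ ^ 2) * ouNorm s x) s := by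
  have hV := ouVar_pos hs
  have h1 := (hasDerivAt_ouVar s).rpow_const (p := -(n : ℝ) / 2) (Or.inl hV.ne')
  have h2 := ((((((hasDerivAt_exp_neg s).pow 2).div (hasDerivAt_ouVar s) hV.ne').neg.mul_const
    (‖x‖ ^ 2)).div_const 2)).exp
  convert! (h1.const_mul ((2 * Real.pi) ^ (-(n : ℝ) / 2))).mul h2 using 1
  rw [Real.rpow_sub_one hV.ne']
  simp only [ouNorm, Pi.neg_apply, Pi.div_apply, Pi.pow_apply]
  field_simp
  ring

lemma TemperedFun.hasDerivAt_ou {g : En n → ℝ} (hg : TemperedFun g) {s : ℝ} (hs : 0 < s)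
    (x : En n) : HasDerivAt (fun s => ou n s g x) (ouDt g s x) s := by
  have hV := ouVar_pos hs
  have h0 : (fun s => ou n s g x) =ᶠ[𝓝 s] fun s => ouNorm s x * tilt g (ouPar s x) :=
    (eventually_gt_nhds hs).mono fun t ht => ou_eq_tilt ht g x
  have hpar : HasDerivAt (fun s => ouPar s x) (-(Real.exp (-s) / ouVar s) ^ 2,
      (-(Real.exp (-s) / ouVar s) * (1 + 2 * (Real.exp (-s) ^ 2 / ouVar s))) • x) s := by
    refine HasDerivAt.prodMk ?_ (HasDerivAt.smul_const ?_ x)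
    · convert! ((hasDerivAt_ouVar s).inv hV.ne').div_const 2 using 1
      field_simp
    · convert! (hasDerivAt_exp_neg s).div (hasDerivAt_ouVar s) hV.ne' using 1
      field_simp
      ring
  have htilt :=
    (hg.hasFDerivAt_tilt (ouPar_fst_pos hs x)).1.differentiableAt.hasFDerivAt.comp_hasDerivAt
    s hpar
  refine HasDerivAt.congr_of_eventuallyEq ?_ h0
  convert! (hasDerivAt_ouNorm hs x).mul htilt using 1
  simp only [hg.fderiv_tilt_apply (ouPar_fst_pos hs x), ouDt, ou_eq_tilt hs, Function.comp,
    PiLp.smul_apply, smul_eq_mul, mul_assoc, mul_left_comm _ (ouNorm s x), ← Finset.mul_sum]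
  ring

end OrnsteinUhlenbeck

section PartialDerivatives

variable {n : ℕ} {v w : En n → ℝ} {x : En n}

lemma pd_add (i : Fin n) (hv : DifferentiableAt ℝ v x) (hw : DifferentiableAt ℝ w x) :
    pd i (fun y => v y + w y) x = pd i v x + pd i w x := by
  rw [pd, fderiv_fun_add hv hw]
  rfl

lemma pd_sub (i : Fin n) (hv : DifferentiableAt ℝ v x) (hw : DifferentiableAt ℝ w x) :
    pd i (fun y => v y - w y) x = pd i v x - pd i w x := by
  rw [pd, fderiv_fun_sub hv hw]
  rfl

lemma pd_mul (i : Fin n) (hv : DifferentiableAt ℝ v x) (hw : DifferentiableAt ℝ w x) :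
    pd i (fun y => v y * w y) x = pd i v x * w x + v x * pd i w x := by
  rw [pd, fderiv_fun_mul hv hw]
  simp only [pd, add_apply, smul_apply, smul_eq_mul]
  ring

lemma pd_const_mul (i : Fin n) (c : ℝ) (hw : DifferentiableAt ℝ w x) :
    pd i (fun y => c * w y) x = c * pd i w x := by
  rw [pd, fderiv_const_mul hw]
  rfl

lemma pd_sum {ι : Type*} {t : Finset ι} {w : ι → En n → ℝ} (i : Fin n)
    (hw : ∀ j ∈ t, DifferentiableAt ℝ (w j) x) :
    pd i (fun y => ∑ j ∈ t, w j y) x = ∑ j ∈ t, pd i (w j) x := by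
  rw [pd, fderiv_fun_sum hw]
  simp [pd]

lemma pd_coord (i j : Fin n) : pd i (fun y => y j) x = if i = j then 1 else 0 := by
  have h : HasFDerivAt (fun y : En n => y j) (EuclideanSpace.proj j : En n →L[ℝ] ℝ) x :=
    (EuclideanSpace.proj j : En n →L[ℝ] ℝ).hasFDerivAt
  rw [pd, h.fderiv]
  simp [eq_comm]

/-- Chain rule for composition with a function of one variable. -/
lemma pd_comp (i : Fin n) {f : ℝ → ℝ} {f' : ℝ} (hf : HasDerivAt f f' (w x))
    (hw : DifferentiableAt ℝ w x) : pd i (fun y => f (w y)) x = f' * pd i w x := by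
  have h : HasFDerivAt (fun y => f (w y)) (f' • fderiv ℝ w x) x :=
    hf.comp_hasFDerivAt x hw.hasFDerivAt
  rw [pd, h.fderiv]
  rfl

lemma ContDiff.pd {k : ℕ} (i : Fin n) (h : ContDiff ℝ (k + 1 : ℕ) w) : ContDiff ℝ k (pd i w) := by
  rw [Nat.cast_add, Nat.cast_one, contDiff_succ_iff_fderiv] at h
  exact h.2.2.clm_apply contDiff_const

lemma ContDiff.differentiableAt_of_succ {k : ℕ} (h : ContDiff ℝ (k + 1 : ℕ) w) :
    DifferentiableAt ℝ w x :=
  (h.differentiable (by simp)).differentiableAt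

/-- Commutator of multiplication by a coordinate with the generator. -/
lemma ouGen_coord_mul (i : Fin n) (hw : ContDiff ℝ 2 w) :
    ouGen (fun y => y i * w y) x = x i * ouGen w x + 2 * pd i w x - x i * w x := by
  have hw' : ContDiff ℝ (1 + 1 : ℕ) w := by exact_mod_cast hw
  have hd : ∀ y, DifferentiableAt ℝ w y := fun y => hw'.differentiableAt_of_succ
  have hc : ∀ y, DifferentiableAt ℝ (fun y : En n => y i) y := fun y => by fun_prop
  have h1 : ∀ j, pd j (fun y => y i * w y)
      = fun y => (if j = i then 1 else 0) * w y + y i * pd j w y := fun j => funext fun y => by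
    rw [pd_mul j (hc y) (hd y), pd_coord]
  have hp : ∀ j, DifferentiableAt ℝ (pd j w) x := fun j =>
    (hw'.pd j).differentiableAt_of_succ (k := 0)
  have h2 : ∀ j, pd j (pd j (fun y => y i * w y)) x
      = (if j = i then 1 else 0) * (2 * pd j w x) + x i * pd j (pd j w) x := fun j => by
    rw [h1, pd_add j ((hd x).const_mul _) ((hc x).fun_mul (hp j)), pd_const_mul j _ (hd x),
      pd_mul j (hc x) (hp j), pd_coord]
    ring
  simp only [ouGen, h2]
  simp only [h1, Finset.mul_sum]
  have h3 : ∀ j : Fin n, (if j = i then (1 : ℝ) else 0) * (2 * pd j w x) + x i * pd j (pd j w) x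
      - x j * ((if j = i then 1 else 0) * w x + x i * pd j w x)
      = x i * (pd j (pd j w) x - x j * pd j w x)
        + (if j = i then 2 * pd j w x - x j * w x else 0) := fun j => by
    split_ifs <;> ring
  rw [Finset.sum_congr rfl fun j _ => h3 j, Finset.sum_add_distrib, Finset.sum_ite_eq']
  simp
  ring

lemma ouGen_const_mul (c : ℝ) (hw : ContDiff ℝ 2 w) :
    ouGen (fun y => c * w y) x = c * ouGen w x := by
  have hw' : ContDiff ℝ (1 + 1 : ℕ) w := by exact_mod_cast hw
  have h1 : ∀ j, pd j (fun y => c * w y) = fun y => c * pd j w y := fun j => funext fun y =>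
    pd_const_mul j c hw'.differentiableAt_of_succ
  simp only [ouGen, h1, Finset.mul_sum]
  refine Finset.sum_congr rfl fun j _ => ?_
  rw [pd_const_mul j c ((hw'.pd j).differentiableAt_of_succ (k := 0))]
  ring

lemma ouGen_sub (hv : ContDiff ℝ 2 v) (hw : ContDiff ℝ 2 w) :
    ouGen (fun y => v y - w y) x = ouGen v x - ouGen w x := by
  have hv' : ContDiff ℝ (1 + 1 : ℕ) v := by exact_mod_cast hv
  have hw' : ContDiff ℝ (1 + 1 : ℕ) w := by exact_mod_cast hw
  have h1 : ∀ j, pd j (fun y => v y - w y) = fun y => pd j v y - pd j w y := fun j =>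
    funext fun y => pd_sub j hv'.differentiableAt_of_succ hw'.differentiableAt_of_succ
  simp only [ouGen, h1, ← Finset.sum_sub_distrib]
  refine Finset.sum_congr rfl fun j _ => ?_
  rw [pd_sub j ((hv'.pd j).differentiableAt_of_succ (k := 0))
    ((hw'.pd j).differentiableAt_of_succ (k := 0))]
  ring

end PartialDerivatives

section HeatEquation

variable {n : ℕ} {g : En n → ℝ} {s : ℝ}

lemma sum_ou_coord_mul_coord_mul (hg : TemperedFun g) (hs : 0 < s) (x : En n) :
    ∑ i, ou n s (fun z => z i * (z i * g z)) x = ou n s (fun z => ‖z‖ ^ 2 * g z) x := by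
  simp only [ou_eq_tilt hs, ← Finset.mul_sum, tilt]
  rw [← integral_finsetSum _ fun i _ =>
    ((hg.coord_mul i).coord_mul i).integrable_tiltExp_mul (ouPar_fst_pos hs x)]
  congr 2
  ext z
  rw [← Finset.mul_sum, EuclideanSpace.real_norm_sq_eq, Finset.sum_mul]
  congr 1
  exact Finset.sum_congr rfl fun i _ => by ring

lemma TemperedFun.differentiableAt_ou (hg : TemperedFun g) (hs : 0 < s) (x : En n) :
    DifferentiableAt ℝ (ou n s g) x :=
  (hg.hasFDerivAt_ou hs x).differentiableAt

lemma TemperedFun.pd_pd_ou (hg : TemperedFun g) (hs : 0 < s) (i j : Fin n) (x : En n) :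
    pd j (pd i (ou n s g)) x = Real.exp (-s) / ouVar s *
      (pd j (ou n s (fun z => z i * g z)) x - Real.exp (-s) * ((if j = i then 1 else 0) * ou n s g x
        + x i * pd j (ou n s g) x)) := by
  have hc : DifferentiableAt ℝ (fun y : En n => y i) x := by fun_prop
  have h0 := hg.differentiableAt_ou hs x
  have h1 := (hg.coord_mul i).differentiableAt_ou hs x
  rw [hg.pd_ou hs i, pd_const_mul, pd_sub]
  · simp only [mul_assoc]
    rw [pd_const_mul, pd_mul j hc h0, pd_coord]
    exact hc.mul h0
  · exact h1
  · fun_prop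
  · fun_prop

/-- The Ornstein–Uhlenbeck semigroup solves the heat equation of its generator. -/
lemma TemperedFun.ouDt_eq_ouGen (hg : TemperedFun g) (hs : 0 < s) (x : En n) :
    ouDt g s x = ouGen (ou n s g) x := by
  have hV := ouVar_pos hs
  have h1 : ∀ i, pd i (pd i (ou n s g)) x - x i * pd i (ou n s g) x
      = -(Real.exp (-s) ^ 2 / ouVar s) * ou n s g x
        + (Real.exp (-s) ^ 2 / ouVar s + (Real.exp (-s) ^ 2 / ouVar s) ^ 2) * ou n s g x * x i ^ 2
        + (Real.exp (-s) / ouVar s) ^ 2 * ou n s (fun z => z i * (z i * g z)) x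
        - (Real.exp (-s) / ouVar s) * (1 + 2 * (Real.exp (-s) ^ 2 / ouVar s))
          * (x i * ou n s (fun z => z i * g z) x) := fun i => by
    rw [hg.pd_pd_ou hs, hg.pd_ou hs, (hg.coord_mul i).pd_ou hs, if_pos rfl]
    ring
  rw [ouGen, Finset.sum_congr rfl fun i _ => h1 i, Finset.sum_sub_distrib, Finset.sum_add_distrib,
    Finset.sum_add_distrib, Finset.sum_const, ← Finset.mul_sum, ← Finset.mul_sum, ← Finset.mul_sum,
    sum_ou_coord_mul_coord_mul hg hs, ← EuclideanSpace.real_norm_sq_eq, ouDt, Finset.card_univ,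
    Fintype.card_fin, nsmul_eq_mul]
  ring

lemma TemperedFun.ouGen_pd_ou (hg : TemperedFun g) (hs : 0 < s) (i : Fin n) (x : En n) :
    ouGen (pd i (ou n s g)) x = Real.exp (-s) / ouVar s *
      (ouGen (ou n s (fun z => z i * g z)) x - Real.exp (-s) * (x i * ouGen (ou n s g) x
        + 2 * pd i (ou n s g) x - x i * ou n s g x)) := by
  have hc0 : ContDiff ℝ 2 (ou n s g) := by exact_mod_cast hg.contDiff_ou hs 2
  have hc1 : ContDiff ℝ 2 (ou n s fun z => z i * g z) := by
    exact_mod_cast (hg.coord_mul i).contDiff_ou hs 2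
  have hx : ContDiff ℝ 2 fun y : En n => y i * ou n s g y := by fun_prop
  rw [hg.pd_ou hs i]
  simp only [mul_assoc]
  rw [ouGen_const_mul _ (by fun_prop), ouGen_sub hc1 (by fun_prop), ouGen_const_mul _ hx,
    ouGen_coord_mul i hc0, hg.pd_ou hs i]
  simp only [mul_assoc]

lemma TemperedFun.hasDerivAt_pd_ou (hg : TemperedFun g) (hs : 0 < s) (i : Fin n) (x : En n) :
    HasDerivAt (fun s => pd i (ou n s g) x)
      (ouGen (pd i (ou n s g)) x - pd i (ou n s g) x) s := by
  have hV := ouVar_pos hs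
  have hk : HasDerivAt (fun s => Real.exp (-s) / ouVar s)
      (-(Real.exp (-s) / ouVar s) * (1 + 2 * (Real.exp (-s) ^ 2 / ouVar s))) s := by
    convert! (hasDerivAt_exp_neg s).div (hasDerivAt_ouVar s) hV.ne' using 1
    field_simp
    ring
  have h0 := hg.hasDerivAt_ou hs x
  have h1 := (hg.coord_mul i).hasDerivAt_ou hs x
  rw [hg.ouDt_eq_ouGen hs] at h0
  rw [(hg.coord_mul i).ouDt_eq_ouGen hs] at h1
  have hev : (fun s => pd i (ou n s g) x) =ᶠ[nhds s] fun s => Real.exp (-s) / ouVar s *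
      (ou n s (fun z => z i * g z) x - Real.exp (-s) * x i * ou n s g x) :=
    (eventually_gt_nhds hs).mono fun t ht => by simp only [hg.pd_ou ht]
  refine HasDerivAt.congr_of_eventuallyEq ?_ hev
  convert! hk.mul (h1.sub (((hasDerivAt_exp_neg s).mul_const (x i)).mul h0)) using 1
  rw [hg.ouGen_pd_ou hs, hg.pd_ou hs i]
  simp only [Pi.sub_apply, Pi.mul_apply]
  ring

end HeatEquation

section UniformBounds

variable {n : ℕ} {g : En n → ℝ} {s₁ : ℝ}

lemma integrable_one_add_norm_pow (k : ℕ) :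
    Integrable (fun y : En n => (1 + ‖y‖) ^ k) (gaussE n) :=
  TemperedFun.integrable_gaussE ⟨by fun_prop, 1, k, fun _ _ y => by
    rw [one_mul, abs_of_nonneg (by positivity)]⟩

lemma TemperedFun.polyBdd_ou (hg : TemperedFun g) :
    PolyBdd (Set.Ioi 0) fun s x => ou n s g x := by
  obtain ⟨C, k, hC, h⟩ := hg.polyBdd.exists_nonneg
  refine ⟨C * ∫ y, (1 + ‖y‖) ^ k ∂(gaussE n), k, fun s hs x => ?_⟩
  change ‖ou n s g x‖ ≤ _
  rw [ou, mul_right_comm, ← integral_const_mul]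
  refine norm_integral_le_of_norm_le ((integrable_one_add_norm_pow k).const_mul _)
    (ae_of_all _ fun y => ?_)
  refine (h 0 trivial _).trans ?_
  rw [mul_assoc, ← mul_pow]
  have h1 : ‖Real.exp (-s) • x‖ ≤ ‖x‖ := by
    rw [norm_smul, Real.norm_eq_abs, Real.abs_exp]
    exact mul_le_of_le_one_left (norm_nonneg x) (Real.exp_le_one_iff.2 (by simpa using hs.le))
  have h2 : ‖Real.sqrt (1 - Real.exp (-2 * s)) • y‖ ≤ ‖y‖ := by
    rw [norm_smul, Real.norm_eq_abs, abs_of_nonneg (Real.sqrt_nonneg _)]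
    exact mul_le_of_le_one_left (norm_nonneg y) (Real.sqrt_le_one.2 (ouVar_le_one s))
  have h3 := (norm_add_le _ _).trans (add_le_add h1 h2)
  have h4 : 0 ≤ ‖x‖ * ‖y‖ := by positivity
  gcongr
  linarith

lemma polyBdd_exp_neg : PolyBdd (n := n) (Set.Ioi 0) fun s _ => Real.exp (-s) :=
  PolyBdd.time (K := 1) fun s hs => by
    rw [Real.abs_exp]
    exact Real.exp_le_one_iff.2 (by simpa using (Set.mem_Ioi.1 hs).le)

lemma Ici_subset_Ioi_zero (hs₁ : 0 < s₁) : Set.Ici s₁ ⊆ Set.Ioi 0 :=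
  fun _ hs => hs₁.trans_le hs

lemma exp_neg_div_ouVar_le (hs₁ : 0 < s₁) {s : ℝ} (hs : s₁ ≤ s) :
    Real.exp (-s) / ouVar s ≤ (ouVar s₁)⁻¹ := by
  have hV := ouVar_pos hs₁
  rw [← one_div]
  exact div_le_div₀ zero_le_one (Real.exp_le_one_iff.2 (by linarith)) hV (ouVar_mono hs)

lemma polyBdd_exp_neg_div_ouVar (hs₁ : 0 < s₁) :
    PolyBdd (n := n) (Set.Ici s₁) fun s _ => Real.exp (-s) / ouVar s :=
  PolyBdd.time (K := (ouVar s₁)⁻¹) fun s hs => by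
    rw [abs_of_nonneg (div_nonneg (Real.exp_pos _).le (ouVar_pos (hs₁.trans_le hs)).le)]
    exact exp_neg_div_ouVar_le hs₁ hs

lemma TemperedFun.polyBdd_pd_ou (hg : TemperedFun g) (hs₁ : 0 < s₁) (i : Fin n) :
    PolyBdd (Set.Ici s₁) fun s x => pd i (ou n s g) x := by
  have h := Ici_subset_Ioi_zero hs₁
  refine ((polyBdd_exp_neg_div_ouVar hs₁).mul (((hg.coord_mul i).polyBdd_ou.mono h).sub
    (((polyBdd_exp_neg.mono h).mul (PolyBdd.coord i)).mul (hg.polyBdd_ou.mono h)))).of_abs_le ?_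
  intro s hs x
  rw [hg.pd_ou (h hs)]

lemma TemperedFun.polyBdd_pd_pd_ou (hg : TemperedFun g) (hs₁ : 0 < s₁) (i j : Fin n) :
    PolyBdd (Set.Ici s₁) fun s x => pd j (pd i (ou n s g)) x := by
  have h := Ici_subset_Ioi_zero hs₁
  refine ((polyBdd_exp_neg_div_ouVar hs₁).mul (((hg.coord_mul i).polyBdd_pd_ou hs₁ j).sub
    ((polyBdd_exp_neg.mono h).mul (((PolyBdd.const (if j = i then 1 else 0)).mul
      (hg.polyBdd_ou.mono h)).add ((PolyBdd.coord i).mul (hg.polyBdd_pd_ou hs₁ j)))))).of_abs_le ?_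
  intro s hs x
  rw [hg.pd_pd_ou (h hs)]

lemma TemperedFun.polyBdd_ouGen_ou (hg : TemperedFun g) (hs₁ : 0 < s₁) :
    PolyBdd (Set.Ici s₁) fun s x => ouGen (ou n s g) x :=
  PolyBdd.sum fun i _ => (hg.polyBdd_pd_pd_ou hs₁ i i).sub
    ((PolyBdd.coord i).mul (hg.polyBdd_pd_ou hs₁ i))

lemma TemperedFun.polyBdd_ouGen_pd_ou (hg : TemperedFun g) (hs₁ : 0 < s₁) (i : Fin n) :
    PolyBdd (Set.Ici s₁) fun s x => ouGen (pd i (ou n s g)) x := by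
  have h := Ici_subset_Ioi_zero hs₁
  refine ((polyBdd_exp_neg_div_ouVar hs₁).mul (((hg.coord_mul i).polyBdd_ouGen_ou hs₁).sub
    ((polyBdd_exp_neg.mono h).mul ((((PolyBdd.coord i).mul (hg.polyBdd_ouGen_ou hs₁)).add
      ((PolyBdd.const 2).mul (hg.polyBdd_pd_ou hs₁ i))).sub
        ((PolyBdd.coord i).mul (hg.polyBdd_ou.mono h)))))).of_abs_le ?_
  intro s hs x
  rw [hg.ouGen_pd_ou (h hs)]

lemma integral_exp_neg_mul_pos (hg : TemperedFun g) (h0 : 0 ≤ g) (hpos : 0 < ∫ x, g x ∂(gaussE n))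
    {α : ℝ} (hα : 0 < α) : 0 < ∫ z, Real.exp (-α * ‖z‖ ^ 2) * g z := by
  rw [integral_pos_iff_support_of_nonneg (fun z => mul_nonneg (Real.exp_pos _).le (h0 z))
    (hg.integrable_exp_mul hα)]
  refine pos_iff_ne_zero.2 fun hz => hpos.ne' ?_
  rw [integral_gaussE]
  refine integral_eq_zero_of_ae ?_
  filter_upwards [measure_eq_zero_iff_ae_notMem.1 hz] with z hz
  have : g z = 0 := by simpa [Real.exp_ne_zero] using hz
  simp [this]

/-- Gaussian lower bound for the Ornstein–Uhlenbeck semigroup. -/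
lemma TemperedFun.exists_le_ou (hg : TemperedFun g) (h0 : 0 ≤ g)
    (hpos : 0 < ∫ x, g x ∂(gaussE n)) (hs₁ : 0 < s₁) :
    ∃ c K : ℝ, 0 < c ∧ 0 ≤ K ∧ ∀ s, s₁ ≤ s → ∀ x,
      c * Real.exp (-(K * ‖x‖ ^ 2)) ≤ ou n s g x := by
  have hV := ouVar_pos hs₁
  set R := (ouVar s₁)⁻¹ with hR
  have hR0 : 0 < R := inv_pos.2 hV
  have hm := integral_exp_neg_mul_pos hg h0 hpos (α := R / 2 + 1 / 2) (by positivity)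
  set m := ∫ z, Real.exp (-(R / 2 + 1 / 2) * ‖z‖ ^ 2) * g z with hm'
  refine ⟨(2 * Real.pi) ^ (-(n : ℝ) / 2) * m, R / 2 + R ^ 2 / 2, by positivity, by positivity,
    fun s hs x => ?_⟩
  have hs0 := hs₁.trans_le hs
  have hVs := ouVar_pos hs0
  have ha1 : Real.exp (-s) ≤ 1 := Real.exp_le_one_iff.2 (by linarith)
  have hinv : (ouVar s)⁻¹ ≤ R := inv_anti₀ hV (ouVar_mono hs)
  have hk := exp_neg_div_ouVar_le hs₁ hs
  have hk0 : 0 ≤ Real.exp (-s) / ouVar s := by positivity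
  have hnorm : (2 * Real.pi) ^ (-(n : ℝ) / 2) * Real.exp (-(R / 2 * ‖x‖ ^ 2)) ≤ ouNorm s x := by
    have h1 : 1 ≤ (ouVar s) ^ (-(n : ℝ) / 2) :=
      Real.one_le_rpow_of_pos_of_le_one_of_nonpos hVs (ouVar_le_one s)
        (by have : (0 : ℝ) ≤ n := n.cast_nonneg
            linarith)
    have h2 : Real.exp (-s) ^ 2 / ouVar s ≤ R := by
      rw [sq, mul_div_assoc]
      exact (mul_le_of_le_one_left hk0 ha1).trans hk
    have h3 : Real.exp (-s) ^ 2 / ouVar s * ‖x‖ ^ 2 ≤ R * ‖x‖ ^ 2 := by gcongr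
    rw [ouNorm]
    refine mul_le_mul (le_mul_of_one_le_right (by positivity) h1) (Real.exp_le_exp.2 ?_)
      (by positivity) (by positivity)
    linarith
  have htilt : Real.exp (-(R ^ 2 / 2 * ‖x‖ ^ 2)) * m ≤ tilt g (ouPar s x) := by
    rw [hm', ← integral_const_mul]
    refine integral_mono ((hg.integrable_exp_mul (by positivity)).const_mul _)
      (hg.integrable_tiltExp_mul (ouPar_fst_pos hs0 x)) fun z => ?_
    simp only [← mul_assoc, ← Real.exp_add, tiltExp, ouPar]
    refine mul_le_mul_of_nonneg_right (Real.exp_le_exp.2 ?_) (h0 z)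
    set β := (Real.exp (-s) / ouVar s) • x with hβ
    have h1 : ‖β‖ ≤ R * ‖x‖ := by
      rw [hβ, norm_smul, Real.norm_eq_abs, abs_of_nonneg hk0]
      gcongr
    have h2 : ‖β‖ ^ 2 ≤ R ^ 2 * ‖x‖ ^ 2 := by
      rw [← mul_pow]
      gcongr
    have h3 := norm_add_sq_real β z
    have h4 := sq_nonneg ‖β + z‖
    have h5 : (ouVar s)⁻¹ * ‖z‖ ^ 2 ≤ R * ‖z‖ ^ 2 := by gcongr
    linarith
  rw [ou_eq_tilt hs0]
  calc _ = ((2 * Real.pi) ^ (-(n : ℝ) / 2) * Real.exp (-(R / 2 * ‖x‖ ^ 2)))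
        * (Real.exp (-(R ^ 2 / 2 * ‖x‖ ^ 2)) * m) := by
        rw [add_mul, neg_add, Real.exp_add]
        ring
    _ ≤ _ := mul_le_mul hnorm htilt (by positivity) ((by positivity : (0 : ℝ) ≤ _).trans hnorm)

/-- Measurable `[0,1]`-valued functions that are not almost everywhere `0` or `1`. -/
structure UnitFun (f : En n → ℝ) : Prop where
  measurable : Measurable f
  mem_Icc : ∀ x, f x ∈ Set.Icc (0 : ℝ) 1
  integral_pos : 0 < ∫ x, f x ∂(gaussE n)
  integral_lt_one : ∫ x, f x ∂(gaussE n) < 1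

namespace UnitFun

variable {f : En n → ℝ}

lemma tempered (hf : UnitFun f) : TemperedFun f := .of_mem_Icc hf.measurable hf.mem_Icc

lemma one_sub (hf : UnitFun f) : UnitFun fun x => 1 - f x where
  measurable := hf.measurable.const_sub 1
  mem_Icc x := ⟨sub_nonneg.2 (hf.mem_Icc x).2, sub_le_self 1 (hf.mem_Icc x).1⟩
  integral_pos := by
    rw [integral_sub (integrable_const _) hf.tempered.integrable_gaussE]
    simpa using hf.integral_lt_one
  integral_lt_one := by
    rw [integral_sub (integrable_const _) hf.tempered.integrable_gaussE]
    simpa using hf.integral_pos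

lemma ou_one_sub (hf : UnitFun f) (s : ℝ) (x : En n) :
    ou n s (fun x => 1 - f x) x = 1 - ou n s f x := by
  rw [ou, integral_sub (integrable_const _)]
  · simp [ou]
  · exact (TemperedFun.of_mem_Icc (hf.measurable.comp (by fun_prop))
      fun y => hf.mem_Icc _).integrable_gaussE

lemma exists_exp_le_ou (hf : UnitFun f) (hs₁ : 0 < s₁) :
    ∃ L : ℝ, 0 ≤ L ∧ ∀ s, s₁ ≤ s → ∀ x,
      Real.exp (-((L * (1 + ‖x‖)) ^ 2) / 2) ≤ ou n s f x := by
  obtain ⟨c, K, hc, hK, h⟩ := hf.tempered.exists_le_ou (fun x => (hf.mem_Icc x).1)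
    hf.integral_pos hs₁
  set L := 2 * (K + |Real.log c|) + 1 with hL
  have hL1 : 1 ≤ L := by linarith [abs_nonneg (Real.log c)]
  refine ⟨L, by linarith, fun s hs x => le_trans ?_ (h s hs x)⟩
  rw [← Real.exp_log hc, ← Real.exp_add, Real.exp_le_exp]
  have h1 : L * (1 + ‖x‖ ^ 2) ≤ (L * (1 + ‖x‖)) ^ 2 := by
    have := norm_nonneg x
    rw [mul_pow]
    gcongr
    · nlinarith
    · nlinarith
  have h2 := neg_abs_le (Real.log c)
  have h3 : 0 ≤ |Real.log c| * ‖x‖ ^ 2 := by positivity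
  have h4 : 0 ≤ K := hK
  have h5 : L * (1 + ‖x‖ ^ 2) = 2 * K + 2 * |Real.log c| + 1 + 2 * (K * ‖x‖ ^ 2)
    + 2 * (|Real.log c| * ‖x‖ ^ 2) + ‖x‖ ^ 2 := by rw [hL]; ring
  nlinarith [sq_nonneg ‖x‖]

lemma ou_mem_Ioo (hf : UnitFun f) {s : ℝ} (hs : 0 < s) (x : En n) :
    ou n s f x ∈ Set.Ioo (0 : ℝ) 1 := by
  obtain ⟨L, -, h⟩ := hf.exists_exp_le_ou hs
  obtain ⟨M, -, h'⟩ := hf.one_sub.exists_exp_le_ou hs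
  have h1 := (Real.exp_pos _).trans_le (h s le_rfl x)
  have h2 := (Real.exp_pos _).trans_le (h' s le_rfl x)
  rw [hf.ou_one_sub] at h2
  exact ⟨h1, by linarith⟩

lemma polyBdd_gaussQuantile_ou (hf : UnitFun f) (hs₁ : 0 < s₁) :
    PolyBdd (Set.Ici s₁) fun s x => gaussQuantile (ou n s f x) := by
  obtain ⟨L, hL, h⟩ := hf.exists_exp_le_ou hs₁
  obtain ⟨M, hM, h'⟩ := hf.one_sub.exists_exp_le_ou hs₁
  have key : ∀ A : ℝ, 0 ≤ A → A ≤ L + M → ∀ x : En n, Real.exp (-(((L + M) * (1 + ‖x‖)) ^ 2) / 2)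
      ≤ Real.exp (-((A * (1 + ‖x‖)) ^ 2) / 2) := fun A hA hAL x => by
    gcongr
  refine ⟨L + M, 1, fun s hs x => ?_⟩
  rw [pow_one]
  refine abs_gaussQuantile_le (by positivity) (hf.ou_mem_Ioo (hs₁.trans_le hs) x)
    ((key L hL (by linarith) x).trans (h s hs x)) ?_
  rw [← hf.ou_one_sub]
  exact (key M hM (by linarith) x).trans (h' s hs x)

end UnitFun

end UniformBounds

section IntegrationByParts

variable {n : ℕ}

open Filter Topology

lemma exists_cutoff_seq (n : ℕ) :
    ∃ (η : ℕ → En n → ℝ) (M : ℝ), (∀ m, ContDiff ℝ 1 (η m)) ∧ (∀ m, HasCompactSupport (η m)) ∧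
      (∀ m x, η m x ∈ Set.Icc (0 : ℝ) 1) ∧ (∀ x, Tendsto (fun m => η m x) atTop (𝓝 1)) ∧
      ∀ m j x, |pd j (η m) x| ≤ M * (1 / ((m : ℝ) + 1)) := by
  let b : ContDiffBump (0 : En n) := ⟨1, 2, one_pos, one_lt_two⟩
  have hb : ContDiff ℝ 1 b := b.contDiff
  obtain ⟨M, hM⟩ := (b.hasCompactSupport.fderiv ℝ).exists_bound_of_continuous
    (hb.continuous_fderiv one_ne_zero)
  have hc : ∀ m : ℕ, (1 / ((m : ℝ) + 1)) ≠ 0 := fun m => by positivity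
  refine ⟨fun m x => b ((1 / ((m : ℝ) + 1)) • x), M, fun m => by fun_prop, fun m => ?_,
    fun m x => ⟨b.nonneg, b.le_one⟩, fun x => ?_, fun m j x => ?_⟩
  · exact b.hasCompactSupport.comp_homeomorph (Homeomorph.smulOfNeZero _ (hc m))
  · have h1 : Tendsto (fun m : ℕ => (1 / ((m : ℝ) + 1)) • x) atTop (𝓝 0) := by
      simpa using (tendsto_one_div_add_atTop_nhds_zero_nat (𝕜 := ℝ)).smul_const x
    refine tendsto_const_nhds.congr' ((h1.eventually b.eventuallyEq_one).mono fun m hm => ?_)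
    simpa using hm.symm
  · have h1 : HasFDerivAt (fun x => b ((1 / ((m : ℝ) + 1)) • x))
        ((fderiv ℝ b ((1 / ((m : ℝ) + 1)) • x)).comp
          ((1 / ((m : ℝ) + 1)) • ContinuousLinearMap.id ℝ (En n))) x :=
      ((hb.differentiable one_ne_zero).differentiableAt.hasFDerivAt).comp x
        ((1 / ((m : ℝ) + 1)) • ContinuousLinearMap.id ℝ (En n)).hasFDerivAt
    rw [pd, h1.fderiv]
    have h2 := (fderiv ℝ b ((1 / ((m : ℝ) + 1)) • x)).le_opNorm (EuclideanSpace.single j 1)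
    have h3 := hM ((1 / ((m : ℝ) + 1)) • x)
    rw [PiLp.norm_single, norm_one, mul_one, Real.norm_eq_abs] at h2
    simp only [ContinuousLinearMap.comp_apply, smul_apply, ContinuousLinearMap.id_apply, map_smul,
      smul_eq_mul, abs_mul]
    rw [abs_of_nonneg (by positivity), mul_comm]
    gcongr
    exact h2.trans h3

lemma pd_gaussDens (j : Fin n) (x : En n) : pd j gaussDens x = -x j * gaussDens x := by
  have h := (((hasStrictFDerivAt_norm_sq x).hasFDerivAt.const_mul (-(1 / 2) : ℝ)).exp).const_mul
    ((2 * Real.pi) ^ (-(n : ℝ) / 2))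
  rw [pd, funext (gaussDens_eq (n := n)), h.fderiv]
  simp [EuclideanSpace.inner_single_right]
  ring

lemma contDiff_gaussDens : ContDiff ℝ 1 (gaussDens (n := n)) := by
  unfold gaussDens
  have : ContDiff ℝ 1 fun x : En n => ‖x‖ ^ 2 := contDiff_norm_sq ℝ
  fun_prop

lemma continuous_pd {g : En n → ℝ} (hg : ContDiff ℝ 1 g) (j : Fin n) : Continuous (pd j g) :=
  contDiff_zero.1 (ContDiff.pd (k := 0) j (by exact_mod_cast hg))

lemma HasCompactSupport.pd {g : En n → ℝ} (hg : HasCompactSupport g) (j : Fin n) :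
    HasCompactSupport (pd j g) :=
  (hg.fderiv ℝ).comp_left (g := fun L : En n →L[ℝ] ℝ => L (EuclideanSpace.single j 1)) rfl

/-- Gaussian integration by parts. -/
lemma integral_pd_sub_coord_mul {g : En n → ℝ} (hg : ContDiff ℝ 1 g) (hc : HasCompactSupport g)
    (j : Fin n) : ∫ x, (pd j g x - x j * g x) ∂(gaussE n) = 0 := by
  have hd := contDiff_gaussDens (n := n)
  have i1 : Integrable fun x => pd j gaussDens x * g x :=
    ((continuous_pd hd j).mul hg.continuous).integrable_of_hasCompactSupport hc.mul_left
  have i2 : Integrable fun x => gaussDens x * pd j g x :=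
    (hd.continuous.mul (continuous_pd hg j)).integrable_of_hasCompactSupport (hc.pd j).mul_left
  have i3 : Integrable fun x => gaussDens x * g x :=
    (hd.continuous.mul hg.continuous).integrable_of_hasCompactSupport hc.mul_left
  have h := integral_mul_fderiv_eq_neg_fderiv_mul_of_integrable (μ := volume) i1 i2 i3
    (fun x _ => (hd.differentiable one_ne_zero).differentiableAt)
    (fun x _ => (hg.differentiable one_ne_zero).differentiableAt)
  change ∫ x, gaussDens x * pd j g x = -∫ x, pd j gaussDens x * g x at h
  rw [integral_gaussE]
  have h2 : ∀ x, gaussDens x * (pd j g x - x j * g x)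
      = gaussDens x * pd j g x + pd j gaussDens x * g x := fun x => by
    rw [pd_gaussDens]
    ring
  simp only [h2]
  rw [integral_add i2 i1, h, neg_add_cancel]

variable {Y : Fin n → En n → ℝ} {F G : En n → ℝ}

lemma integral_le_neg_of_le_div_of_integrable (hY : ∀ j, ContDiff ℝ 1 (Y j))
    (hYi : ∀ j, Integrable (Y j) (gaussE n)) (hF : Integrable F (gaussE n))
    (hG : Integrable G (gaussE n))
    (hle : ∀ x, F x + G x ≤ ∑ j, (pd j (Y j) x - x j * Y j x)) :
    ∫ x, G x ∂(gaussE n) ≤ -∫ x, F x ∂(gaussE n) := by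
  obtain ⟨η, M, hη, hηc, hη01, hη1, hηd⟩ := exists_cutoff_seq n
  have hFG : Integrable (fun x => F x + G x) (gaussE n) := hF.add hG
  have hlim : Tendsto (fun m => ∫ x, η m x * (F x + G x) ∂(gaussE n)) atTop
      (𝓝 (∫ x, (F x + G x) ∂(gaussE n))) := by
    refine tendsto_integral_of_dominated_convergence (fun x => ‖F x + G x‖)
      (fun m => (hη m).continuous.aestronglyMeasurable.mul hFG.aestronglyMeasurable) hFG.norm
      (fun m => ae_of_all _ fun x => ?_) (ae_of_all _ fun x => ?_)
    · rw [norm_mul, Real.norm_of_nonneg (hη01 m x).1]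
      exact mul_le_of_le_one_left (norm_nonneg _) (hη01 m x).2
    · simpa using (hη1 x).mul_const (F x + G x)
  have hbound : ∀ m : ℕ, ∫ x, η m x * (F x + G x) ∂(gaussE n)
      ≤ ∑ j, (M * (1 / ((m : ℝ) + 1))) * ∫ x, |Y j x| ∂(gaussE n) := fun m => by
    have hcont : ∀ j, Continuous (pd j (Y j)) := fun j => continuous_pd (hY j) j
    have hcY := fun j => (hY j).continuous
    have hcη := (hη m).continuous
    have hint : ∀ {w : En n → ℝ}, Continuous w →
        Integrable (fun x => η m x * w x) (gaussE n) := fun {w} hw => by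
      rw [integrable_gaussE_iff]
      exact (continuous_gaussDens.mul (hcη.mul hw)).integrable_of_hasCompactSupport
        (hηc m).mul_right.mul_left
    have hintd : ∀ j, Integrable (fun x => pd j (η m) x * Y j x) (gaussE n) := fun j => by
      rw [integrable_gaussE_iff]
      exact (continuous_gaussDens.mul ((continuous_pd (hη m) j).mul
        (hcY j))).integrable_of_hasCompactSupport ((hηc m).pd j).mul_right.mul_left
    have hd : ∀ j, ∫ x, η m x * (pd j (Y j) x - x j * Y j x) ∂(gaussE n)
        = -∫ x, pd j (η m) x * Y j x ∂(gaussE n) := fun j => by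
      have h := integral_pd_sub_coord_mul ((hη m).mul (hY j)) (hηc m).mul_right j
      have h2 : ∀ x, pd j (fun y => η m y * Y j y) x - x j * (η m x * Y j x)
          = pd j (η m) x * Y j x + η m x * (pd j (Y j) x - x j * Y j x) := fun x => by
        rw [pd_mul j ((hη m).differentiable one_ne_zero).differentiableAt
          ((hY j).differentiable one_ne_zero).differentiableAt]
        ring
      simp only [h2] at h
      rw [integral_add (hintd j) (hint (by fun_prop))] at h
      linarith
    calc ∫ x, η m x * (F x + G x) ∂(gaussE n)
        ≤ ∫ x, η m x * ∑ j, (pd j (Y j) x - x j * Y j x) ∂(gaussE n) := by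
          refine integral_mono (hFG.bdd_mul (c := 1) hcη.aestronglyMeasurable
            (ae_of_all _ fun x => ?_)) (hint (by fun_prop)) fun x =>
              mul_le_mul_of_nonneg_left (hle x) (hη01 m x).1
          rw [Real.norm_of_nonneg (hη01 m x).1]
          exact (hη01 m x).2
      _ = ∑ j, -∫ x, pd j (η m) x * Y j x ∂(gaussE n) := by
          simp only [Finset.mul_sum]
          rw [integral_finsetSum _ fun j _ => hint (by fun_prop)]
          exact Finset.sum_congr rfl fun j _ => hd j
      _ ≤ _ := by
          refine Finset.sum_le_sum fun j _ => ?_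
          rw [← integral_const_mul]
          refine (neg_le_abs _).trans ((Real.norm_eq_abs _).ge.trans
            (norm_integral_le_of_norm_le ((hYi j).abs.const_mul _)
            (ae_of_all _ fun x => ?_)))
          rw [norm_mul]
          exact mul_le_mul_of_nonneg_right (hηd m j x) (abs_nonneg _)
  have hzero : Tendsto (fun m : ℕ => ∑ j, (M * (1 / ((m : ℝ) + 1))) * ∫ x, |Y j x| ∂(gaussE n))
      atTop (𝓝 0) := by
    have := tendsto_finsetSum (Finset.univ : Finset (Fin n)) fun j _ =>
      ((tendsto_one_div_add_atTop_nhds_zero_nat (𝕜 := ℝ)).const_mul M).mul_const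
        (∫ x, |Y j x| ∂(gaussE n))
    simpa using this
  have h := le_of_tendsto_of_tendsto' hlim hzero hbound
  rw [integral_add hF hG] at h
  linarith

/-- A pointwise lower bound for the Gaussian divergence of an integrable field, integrated; the
nonnegative term `G` need not be assumed integrable. -/
lemma integral_le_neg_of_le_div (hY : ∀ j, ContDiff ℝ 1 (Y j))
    (hYi : ∀ j, Integrable (Y j) (gaussE n)) (hF : Integrable F (gaussE n)) (hG : 0 ≤ G)
    (hle : ∀ x, F x + G x ≤ ∑ j, (pd j (Y j) x - x j * Y j x)) :
    ∫ x, G x ∂(gaussE n) ≤ -∫ x, F x ∂(gaussE n) := by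
  by_cases hGi : Integrable G (gaussE n)
  · exact integral_le_neg_of_le_div_of_integrable hY hYi hF hGi hle
  · rw [integral_undef hGi]
    have h := integral_le_neg_of_le_div_of_integrable (G := 0) hY hYi hF (integrable_zero _ _ _)
      fun x => (add_le_add_right (hG x) _).trans (hle x)
    simpa using h

end IntegrationByParts

section StaticInequality

variable {n : ℕ}

/-- The algebraic identity behind the Bochner formula, with the Cauchy–Schwarz inequality. -/
lemma bochner_algebra (p : Fin n → ℝ) (H : Fin n → Fin n → ℝ) (q : Fin n → ℝ)
    (hq : ∀ j, q j = ∑ i, p i * H i j) {a r φ : ℝ} (hr : 0 ≤ r)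
    (hr2 : r ^ 2 * (1 + ∑ i, p i ^ 2) = 1) (hφ : 0 ≤ φ) :
    -∑ i, p i * r * (φ * p i) + φ * (∑ j, ∑ i, H i j ^ 2) * r ^ 3 ≤
      ∑ j, ((-(p j * r) + a * r ^ 3 * q j) * (φ * p j)
        + ∑ i, (H i j * r - p i * (r ^ 3 * q j)) * (φ * (H i j - a * p i * p j))) := by
  set P := ∑ i, p i ^ 2 with hP
  have hin : ∀ j, ∑ i, (H i j * r - p i * (r ^ 3 * q j)) * (φ * (H i j - a * p i * p j))
      = φ * r * (∑ i, H i j ^ 2) - φ * r * a * (q j * p j) - φ * r ^ 3 * q j ^ 2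
        + φ * r ^ 3 * a * P * (q j * p j) := fun j => by
    have h : ∀ i, (H i j * r - p i * (r ^ 3 * q j)) * (φ * (H i j - a * p i * p j))
        = φ * r * H i j ^ 2 - φ * r * a * p j * (p i * H i j) - φ * r ^ 3 * q j * (p i * H i j)
          + φ * r ^ 3 * a * q j * p j * p i ^ 2 := fun i => by ring
    rw [Finset.sum_congr rfl fun i _ => h i, Finset.sum_add_distrib, Finset.sum_sub_distrib,
      Finset.sum_sub_distrib, ← Finset.mul_sum, ← Finset.mul_sum, ← Finset.mul_sum,
      ← Finset.mul_sum, ← hq]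
    ring
  have hout : ∀ j, (-(p j * r) + a * r ^ 3 * q j) * (φ * p j)
        + ∑ i, (H i j * r - p i * (r ^ 3 * q j)) * (φ * (H i j - a * p i * p j))
      = -(p j * r * (φ * p j)) + φ * r * (∑ i, H i j ^ 2) - φ * r ^ 3 * q j ^ 2
        + φ * a * r * (r ^ 2 * (1 + P) - 1) * (q j * p j) := fun j => by
    rw [hin]
    ring
  rw [Finset.sum_congr rfl fun j _ => hout j, hr2]
  simp only [sub_self, mul_zero, zero_mul, add_zero]
  rw [Finset.sum_sub_distrib, Finset.sum_add_distrib, Finset.sum_neg_distrib, ← Finset.mul_sum,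
    ← Finset.mul_sum]
  set S := ∑ j, ∑ i, H i j ^ 2 with hS
  have hCS : ∑ j, q j ^ 2 ≤ P * S := by
    rw [hS, Finset.mul_sum]
    refine Finset.sum_le_sum fun j _ => ?_
    rw [hq]
    exact Finset.sum_mul_sq_le_sq_mul_sq _ _ _
  have h1 : φ * r * S = φ * r * S * (r ^ 2 * (1 + P)) := by rw [hr2, mul_one]
  have h2 : φ * r ^ 3 * ∑ j, q j ^ 2 ≤ φ * r ^ 3 * (P * S) := by gcongr
  nlinarith

/-- Reciprocal of `√(1 + |∇h|²)`. -/
noncomputable def invLift (h : En n → ℝ) (x : En n) : ℝ := (Real.sqrt (1 + ∑ i, pd i h x ^ 2))⁻¹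

variable {h : En n → ℝ}

lemma one_add_sum_sq_pos (x : En n) : 0 < 1 + ∑ i, pd i h x ^ 2 := by positivity

lemma invLift_pos (x : En n) : 0 < invLift h x :=
  inv_pos.2 (Real.sqrt_pos.2 (one_add_sum_sq_pos x))

lemma invLift_sq_mul (x : En n) : invLift h x ^ 2 * (1 + ∑ i, pd i h x ^ 2) = 1 := by
  rw [invLift, inv_pow, Real.sq_sqrt (one_add_sum_sq_pos x).le,
    inv_mul_cancel₀ (one_add_sum_sq_pos x).ne']

lemma invLift_le_one (x : En n) : invLift h x ≤ 1 := by
  have h1 := invLift_sq_mul (h := h) x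
  have h2 := invLift_pos (h := h) x
  have h3 : 0 ≤ ∑ i, pd i h x ^ 2 := by positivity
  nlinarith [mul_nonneg (sq_nonneg (invLift h x)) h3]

lemma abs_pd_mul_invLift_le (i : Fin n) (x : En n) : |pd i h x * invLift h x| ≤ 1 := by
  have h1 := invLift_sq_mul (h := h) x
  have h3 : pd i h x ^ 2 ≤ ∑ i, pd i h x ^ 2 :=
    Finset.single_le_sum (f := fun i => pd i h x ^ 2) (fun i _ => sq_nonneg _) (Finset.mem_univ i)
  rw [abs_le_one_iff_mul_self_le_one]
  nlinarith [mul_le_mul_of_nonneg_left h3 (sq_nonneg (invLift h x)), sq_nonneg (invLift h x)]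

lemma contDiff_invLift (hh : ContDiff ℝ 3 h) : ContDiff ℝ 2 (invLift h) := by
  have hp : ∀ i, ContDiff ℝ 2 (pd i h) := fun i => ContDiff.pd (k := 2) i (by exact_mod_cast hh)
  unfold invLift
  refine ContDiff.inv (ContDiff.sqrt ?_ fun x => (one_add_sum_sq_pos x).ne') fun x =>
    (Real.sqrt_pos.2 (one_add_sum_sq_pos x)).ne'
  fun_prop

lemma pd_invLift (hh : ContDiff ℝ 3 h) (j : Fin n) (x : En n) :
    pd j (invLift h) x = -(invLift h x ^ 3 * ∑ i, pd i h x * pd j (pd i h) x) := by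
  have hp : ∀ i, DifferentiableAt ℝ (pd i h) x := fun i =>
    (ContDiff.pd (k := 2) i (by exact_mod_cast hh)).differentiableAt_of_succ (k := 1)
  have h1 : pd j (fun y => 1 + ∑ i, pd i h y ^ 2) x = 2 * ∑ i, pd i h x * pd j (pd i h) x := by
    simp only [sq]
    rw [pd_add j (by fun_prop) (by fun_prop), pd_sum j (fun i _ => (hp i).fun_mul (hp i)),
      Finset.mul_sum]
    have h2 : pd j (fun _ : En n => (1 : ℝ)) x = 0 := by simp [pd]
    rw [h2, zero_add]
    refine Finset.sum_congr rfl fun i _ => ?_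
    rw [pd_mul j (hp i) (hp i)]
    ring
  have hpos := one_add_sum_sq_pos (h := h) x
  have hd := ((Real.hasDerivAt_sqrt hpos.ne').inv (Real.sqrt_pos.2 hpos).ne')
  have := pd_comp j (w := fun y => 1 + ∑ i, pd i h y ^ 2) hd (by fun_prop)
  rw [h1] at this
  refine this.trans ?_
  rw [invLift]
  field_simp

lemma pd_gaussCdf_comp (hh : ContDiff ℝ 3 h) (i : Fin n) :
    pd i (fun y => gaussCdf (h y)) = fun x => gaussPdf (h x) * pd i h x := funext fun x =>
  pd_comp i (hasDerivAt_gaussCdf _) (hh.differentiable (by simp)).differentiableAt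

lemma pd_pd_gaussCdf_comp (hh : ContDiff ℝ 3 h) (i j : Fin n) (x : En n) :
    pd j (pd i (fun y => gaussCdf (h y))) x
      = gaussPdf (h x) * (pd j (pd i h) x - h x * pd i h x * pd j h x) := by
  have hd : DifferentiableAt ℝ h x := (hh.differentiable (by simp)).differentiableAt
  have hp : DifferentiableAt ℝ (pd i h) x :=
    (ContDiff.pd (k := 2) i (by exact_mod_cast hh)).differentiableAt_of_succ (k := 1)
  rw [pd_gaussCdf_comp hh, pd_mul j _ hp, pd_comp j (hasDerivAt_gaussPdf _) hd]
  · ring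
  · exact (hasDerivAt_gaussPdf _).differentiableAt.comp x hd

/-- Derivative along the Ornstein–Uhlenbeck flow of the integrand `√(φ(h)² + |∇u|²)` of the
Bobkov functional, where `u = Φ ∘ h`. -/
noncomputable def bobkovDt (h : En n → ℝ) (x : En n) : ℝ :=
  -(h x * invLift h x) * ouGen (fun y => gaussCdf (h y)) x
    + ∑ i, pd i h x * invLift h x * (ouGen (pd i fun y => gaussCdf (h y)) x
      - pd i (fun y => gaussCdf (h y)) x)

/-- Vector field whose Gaussian divergence controls `bobkovDt`. -/
noncomputable def bobkovFlux (h : En n → ℝ) (j : Fin n) (x : En n) : ℝ :=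
  -(h x * invLift h x) * pd j (fun y => gaussCdf (h y)) x
    + ∑ i, pd i h x * invLift h x * pd j (pd i fun y => gaussCdf (h y)) x

lemma contDiff_gaussCdf_comp (hh : ContDiff ℝ 3 h) : ContDiff ℝ 3 fun y => gaussCdf (h y) := by
  have := contDiff_gaussCdf (k := 3)
  exact (show ContDiff ℝ 3 gaussCdf by exact_mod_cast this).comp hh

lemma contDiff_bobkovFlux (hh : ContDiff ℝ 3 h) (j : Fin n) : ContDiff ℝ 1 (bobkovFlux h j) := by
  have h0 : ContDiff ℝ 1 h := hh.of_le (by norm_num)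
  have hr : ContDiff ℝ 1 (invLift h) := (contDiff_invLift hh).of_le (by norm_num)
  have hp : ∀ i, ContDiff ℝ 1 (pd i h) := fun i =>
    (ContDiff.pd (k := 2) i (by exact_mod_cast hh)).of_le (by norm_num)
  have hu := contDiff_gaussCdf_comp hh
  have hv : ∀ i, ContDiff ℝ 2 (pd i fun y => gaussCdf (h y)) := fun i =>
    ContDiff.pd (k := 2) i (by exact_mod_cast hu)
  have hv1 : ContDiff ℝ 1 (pd j fun y => gaussCdf (h y)) := (hv j).of_le (by norm_num)
  have hv2 : ∀ i, ContDiff ℝ 1 (pd j (pd i fun y => gaussCdf (h y))) := fun i =>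
    ContDiff.pd (k := 1) j (by exact_mod_cast hv i)
  unfold bobkovFlux
  fun_prop

lemma bobkovDt_add_le_div (hh : ContDiff ℝ 3 h) (x : En n) :
    bobkovDt h x + gaussPdf (h x) * (∑ j, ∑ i, pd j (pd i h) x ^ 2) * invLift h x ^ 3
      ≤ ∑ j, (pd j (bobkovFlux h j) x - x j * bobkovFlux h j x) := by
  have hd : DifferentiableAt ℝ h x := (hh.differentiable (by simp)).differentiableAt
  have hp : ∀ i, DifferentiableAt ℝ (pd i h) x := fun i =>
    (ContDiff.pd (k := 2) i (by exact_mod_cast hh)).differentiableAt_of_succ (k := 1)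
  have hr : DifferentiableAt ℝ (invLift h) x :=
    ((contDiff_invLift hh).differentiable (by simp)).differentiableAt
  have hu := contDiff_gaussCdf_comp hh
  set u := fun y => gaussCdf (h y) with hu'
  have hv' : ∀ i, ContDiff ℝ (1 + 1 : ℕ) (pd i u) := fun i =>
    ContDiff.pd (k := 2) i (by exact_mod_cast hu)
  have hv : ∀ i, DifferentiableAt ℝ (pd i u) x := fun i => (hv' i).differentiableAt_of_succ
  have hvv : ∀ i j, DifferentiableAt ℝ (pd j (pd i u)) x := fun i j =>
    ((hv' i).pd j).differentiableAt_of_succ (k := 0)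
  set r := invLift h x
  set q : Fin n → ℝ := fun j => ∑ i, pd i h x * pd j (pd i h) x with hq
  have hpr : ∀ j, pd j (invLift h) x = -(r ^ 3 * q j) := fun j => pd_invLift hh j x
  have hflux : ∀ j, pd j (bobkovFlux h j) x =
      ((-(pd j h x * r) + h x * r ^ 3 * q j) * pd j u x + -(h x * r) * pd j (pd j u) x)
      + ∑ i, ((pd j (pd i h) x * r - pd i h x * (r ^ 3 * q j)) * pd j (pd i u) x
        + pd i h x * r * pd j (pd j (pd i u)) x) := fun j => by
    unfold bobkovFlux
    rw [pd_add j (by fun_prop) (by fun_prop), pd_sum j fun i _ => by fun_prop,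
      pd_mul j (by fun_prop) (hv j)]
    congr 1
    · have : pd j (fun y => -(h y * invLift h y)) x = -(pd j h x * r) + h x * r ^ 3 * q j := by
        have h1 : (fun y => -(h y * invLift h y)) = fun y => (-1 : ℝ) * (h y * invLift h y) := by
          ext y
          ring
        rw [h1, pd_const_mul j _ (hd.fun_mul hr), pd_mul j hd hr, hpr]
        ring
      rw [this]
    · refine Finset.sum_congr rfl fun i _ => ?_
      rw [pd_mul j ((hp i).fun_mul hr) (hvv i j), pd_mul j (hp i) hr, hpr]
      ring
  have halg := bochner_algebra (fun i => pd i h x) (fun i j => pd j (pd i h) x) q (fun j => rfl)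
    (a := h x) (invLift_pos (h := h) x).le (invLift_sq_mul x) (gaussPdf_pos (h x)).le
  simp only [← pd_pd_gaussCdf_comp hh, ← congrFun (pd_gaussCdf_comp hh _) x] at halg
  clear_value q
  have hsplit : ∑ j, (pd j (bobkovFlux h j) x - x j * bobkovFlux h j x)
      = ∑ j, ((-(pd j h x * r) + h x * r ^ 3 * q j) * pd j u x
          + ∑ i, (pd j (pd i h) x * r - pd i h x * (r ^ 3 * q j)) * pd j (pd i u) x)
        + (-(h x * r) * ouGen u x + ∑ i, pd i h x * r * ouGen (pd i u) x) := by
    simp only [ouGen, Finset.mul_sum]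
    rw [Finset.sum_comm (s := Finset.univ) (t := Finset.univ)
      (f := fun i j => pd i h x * r * (pd j (pd j (pd i u)) x - x j * pd j (pd i u) x)),
      ← Finset.sum_add_distrib, ← Finset.sum_add_distrib]
    refine Finset.sum_congr rfl fun j _ => ?_
    have hx : x j * bobkovFlux h j x
        = -(h x * r) * (x j * pd j u x) + ∑ i, pd i h x * r * (x j * pd j (pd i u) x) := by
      rw [bobkovFlux, mul_add, Finset.mul_sum]
      congr 1
      · ring
      · exact Finset.sum_congr rfl fun i _ => by ring
    rw [hflux, hx, Finset.sum_add_distrib]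
    simp only [mul_sub, Finset.sum_sub_distrib]
    ring
  rw [hsplit, bobkovDt]
  simp only [mul_sub, Finset.sum_sub_distrib]
  linarith

end StaticInequality

section BobkovFunctional

variable {n : ℕ}

open Filter Topology

lemma sq_norm_gradient (w : En n → ℝ) (x : En n) : ‖gradient w x‖ ^ 2 = ∑ i, pd i w x ^ 2 := by
  rw [EuclideanSpace.real_norm_sq_eq]
  refine Finset.sum_congr rfl fun i _ => ?_
  have h := InnerProductSpace.toDual_symm_apply (𝕜 := ℝ) (x := EuclideanSpace.single i (1 : ℝ))
    (y := fderiv ℝ w x)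
  rw [EuclideanSpace.inner_single_right] at h
  rw [pd, ← h]
  simp [gradient]

lemma hessHS2_eq {w : En n → ℝ} (hw : ContDiff ℝ 2 w) (x : En n) :
    hessHS2 n w x = ∑ j, ∑ i, pd j (pd i w) x ^ 2 := by
  have hd : DifferentiableAt ℝ (fderiv ℝ w) x :=
    ((hw.fderiv_right (m := 1) (by norm_num)).differentiable (by simp)).differentiableAt
  refine Finset.sum_congr rfl fun j _ => Finset.sum_congr rfl fun i _ => ?_
  have h : pd j (pd i w) x = fderiv ℝ (fun y => fderiv ℝ w y (EuclideanSpace.single i 1)) x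
      (EuclideanSpace.single j 1) := rfl
  rw [h, fderiv_clm_apply hd (by fun_prop), iteratedFDeriv_two_apply]
  simp

lemma rpow_one_add_sq_norm_gradient (w : En n → ℝ) (x : En n) :
    (1 + ‖gradient w x‖ ^ 2) ^ (-(3 : ℝ) / 2) = invLift w x ^ 3 := by
  have hW := one_add_sum_sq_pos (h := w) x
  rw [sq_norm_gradient, invLift, Real.sqrt_eq_rpow, ← Real.rpow_neg hW.le, ← Real.rpow_natCast,
    ← Real.rpow_mul hW.le]
  norm_num

lemma gaussPdf_le_one (x : ℝ) : gaussPdf x ≤ 1 := by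
  have h1 : (Real.sqrt (2 * Real.pi))⁻¹ ≤ 1 :=
    inv_le_one_of_one_le₀ (Real.one_le_sqrt.2 (by linarith [Real.pi_gt_three]))
  have h2 : Real.exp (-(x ^ 2) / 2) ≤ 1 := Real.exp_le_one_iff.2 (by nlinarith [sq_nonneg x])
  exact mul_le_one₀ h1 (Real.exp_pos _).le h2

lemma PolyBdd.temperedFun {S : Set ℝ} {w : ℝ → En n → ℝ} (h : PolyBdd S w) {s : ℝ} (hs : s ∈ S)
    (hm : Measurable (w s)) : TemperedFun (w s) :=
  let ⟨C, k, h⟩ := h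
  ⟨hm, C, k, fun _ _ x => h s hs x⟩

lemma continuous_ouGen {w : En n → ℝ} (hw : ContDiff ℝ 2 w) : Continuous (ouGen w) := by
  have h1 : ∀ i, ContDiff ℝ 1 (pd i w) := fun i => ContDiff.pd (k := 1) i (by exact_mod_cast hw)
  have h2 := fun i => continuous_pd (h1 i) i
  have h3 := fun i => (h1 i).continuous
  unfold ouGen
  fun_prop

lemma continuous_bobkovDt {h : En n → ℝ} (hh : ContDiff ℝ 3 h) : Continuous (bobkovDt h) := by
  have hu := contDiff_gaussCdf_comp hh
  have hv : ∀ i, ContDiff ℝ 2 (pd i fun y => gaussCdf (h y)) := fun i =>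
    ContDiff.pd (k := 2) i (by exact_mod_cast hu)
  have h0 := hh.continuous
  have h1 := (contDiff_invLift hh).continuous
  have h2 := fun i => continuous_pd (hh.of_le (by norm_num)) i
  have h3 := continuous_ouGen (hu.of_le (by norm_num))
  have h4 := fun i => continuous_ouGen (hv i)
  have h5 := fun i => (hv i).continuous
  unfold bobkovDt
  fun_prop

lemma polyBdd_invLift (h : ℝ → En n → ℝ) (S : Set ℝ) : PolyBdd S fun s x => invLift (h s) x :=
  (PolyBdd.const 1).of_abs_le fun _ _ x => by
    rw [abs_of_pos (invLift_pos x), abs_one]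
    exact invLift_le_one x

lemma polyBdd_pd_mul_invLift (h : ℝ → En n → ℝ) (S : Set ℝ) (i : Fin n) :
    PolyBdd S fun s x => pd i (h s) x * invLift (h s) x :=
  (PolyBdd.const 1).of_abs_le fun _ _ x => by
    rw [abs_one]
    exact abs_pd_mul_invLift_le i x

namespace UnitFun

variable {f : En n → ℝ} {s s₁ : ℝ}

lemma gaussCdf_gaussQuantile_ou (hf : UnitFun f) (hs : 0 < s) :
    (fun y => gaussCdf (gaussQuantile (ou n s f y))) = ou n s f :=
  funext fun y => gaussCdf_gaussQuantile (hf.ou_mem_Ioo hs y)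

lemma contDiff_gaussQuantile_ou (hf : UnitFun f) (hs : 0 < s) :
    ContDiff ℝ 3 fun y => gaussQuantile (ou n s f y) := by
  have h1 := contDiffOn_gaussQuantile 3
  have h2 := hf.tempered.contDiff_ou hs 3
  exact_mod_cast h1.comp_contDiff h2 (hf.ou_mem_Ioo hs)

lemma polyBdd_bobkovDt (hf : UnitFun f) (hs₁ : 0 < s₁) :
    PolyBdd (Set.Ici s₁) fun s x => bobkovDt (fun y => gaussQuantile (ou n s f y)) x := by
  have ht := hf.tempered
  refine (((hf.polyBdd_gaussQuantile_ou hs₁).mul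
      (polyBdd_invLift (fun s y => gaussQuantile (ou n s f y)) _)).neg.mul
    (ht.polyBdd_ouGen_ou hs₁)).add (PolyBdd.sum fun i (_ : i ∈ Finset.univ) =>
      (polyBdd_pd_mul_invLift (fun s y => gaussQuantile (ou n s f y)) _ i).mul
        ((ht.polyBdd_ouGen_pd_ou hs₁ i).sub (ht.polyBdd_pd_ou hs₁ i))) |>.of_abs_le ?_
  intro s hs x
  rw [bobkovDt, hf.gaussCdf_gaussQuantile_ou (hs₁.trans_le hs)]

lemma polyBdd_bobkovFlux (hf : UnitFun f) (hs₁ : 0 < s₁) (j : Fin n) :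
    PolyBdd (Set.Ici s₁) fun s x => bobkovFlux (fun y => gaussQuantile (ou n s f y)) j x := by
  have ht := hf.tempered
  refine (((hf.polyBdd_gaussQuantile_ou hs₁).mul
      (polyBdd_invLift (fun s y => gaussQuantile (ou n s f y)) _)).neg.mul
    (ht.polyBdd_pd_ou hs₁ j)).add (PolyBdd.sum fun i (_ : i ∈ Finset.univ) =>
      (polyBdd_pd_mul_invLift (fun s y => gaussQuantile (ou n s f y)) _ i).mul
        (ht.polyBdd_pd_pd_ou hs₁ i j)) |>.of_abs_le ?_
  intro s hs x
  rw [bobkovFlux, hf.gaussCdf_gaussQuantile_ou (hs₁.trans_le hs)]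

lemma integral_hessHS2_le (hf : UnitFun f) (hs : 0 < s) :
    ∫ x, Igauss (ou n s f x) * hessHS2 n (fun y => gaussQuantile (ou n s f y)) x *
        (1 + ‖gradient (fun y => gaussQuantile (ou n s f y)) x‖ ^ 2) ^ (-(3 : ℝ) / 2) ∂(gaussE n)
      ≤ -∫ x, bobkovDt (fun y => gaussQuantile (ou n s f y)) x ∂(gaussE n) := by
  have hh := hf.contDiff_gaussQuantile_ou hs
  simp only [Igauss_eq (hf.ou_mem_Ioo hs _), hessHS2_eq (hh.of_le (by norm_num)),
    rpow_one_add_sq_norm_gradient]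
  refine integral_le_neg_of_le_div (contDiff_bobkovFlux hh) (fun j => ?_) ?_ (fun x => ?_)
    (bobkovDt_add_le_div hh)
  · exact ((hf.polyBdd_bobkovFlux hs j).temperedFun (s := s) Set.self_mem_Ici
      (contDiff_bobkovFlux hh j).continuous.measurable).integrable_gaussE
  · exact ((hf.polyBdd_bobkovDt hs).temperedFun (s := s) Set.self_mem_Ici
      (continuous_bobkovDt hh).measurable).integrable_gaussE
  · have h1 := gaussPdf_pos (gaussQuantile (ou n s f x))
    have h2 := invLift_pos (h := fun y => gaussQuantile (ou n s f y)) x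
    simp only [Pi.zero_apply]
    positivity

/-- The time derivative of the integrand of the Bobkov functional is `bobkovDt`. -/
lemma hasDerivAt_bobkovIntegrand (hf : UnitFun f) (hs : 0 < s) (x : En n) :
    HasDerivAt (fun s => Real.sqrt (Igauss (ou n s f x) ^ 2 + ‖gradient (ou n s f) x‖ ^ 2))
      (bobkovDt (fun y => gaussQuantile (ou n s f y)) x) s := by
  have ht := hf.tempered
  have hu := hf.ou_mem_Ioo hs x
  have hh := hf.contDiff_gaussQuantile_ou hs
  simp only [sq_norm_gradient]
  have h0 := ht.hasDerivAt_ou hs x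
  rw [ht.ouDt_eq_ouGen hs] at h0
  have hI := ((hasDerivAt_Igauss hu).comp s h0).fun_pow 2
  have hv := HasDerivAt.fun_sum (u := Finset.univ) fun i (_ : i ∈ Finset.univ) =>
    (ht.hasDerivAt_pd_ou hs i x).fun_pow 2
  have hA := hI.add hv
  set h := fun y => gaussQuantile (ou n s f y) with hh'
  have hφ := gaussPdf_pos (h x)
  have hr := invLift_pos (h := h) x
  have hIx : Igauss (ou n s f x) = gaussPdf (h x) := Igauss_eq hu
  have hpd : ∀ i, pd i (ou n s f) x = gaussPdf (h x) * pd i h x := fun i => by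
    rw [← congrFun (pd_gaussCdf_comp hh i) x, hh', hf.gaussCdf_gaussQuantile_ou hs]
  have hval : Igauss (ou n s f x) ^ 2 + ∑ i, pd i (ou n s f) x ^ 2
      = (gaussPdf (h x) * (invLift h x)⁻¹) ^ 2 := by
    simp only [hIx, hpd, mul_pow, ← Finset.mul_sum]
    have := invLift_sq_mul (h := h) x
    field_simp
    linarith
  have hpos : 0 < Igauss (ou n s f x) ^ 2 + ∑ i, pd i (ou n s f) x ^ 2 := by
    rw [hval]
    positivity
  refine (hA.sqrt hpos.ne').congr_deriv ?_
  simp only [Function.comp, Pi.add_apply]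
  rw [hval, Real.sqrt_sq (by positivity), bobkovDt, hh', hf.gaussCdf_gaussQuantile_ou hs, ← hh']
  simp only [hIx, hpd]
  have hq : gaussQuantile (ou n s f x) = h x := rfl
  rw [hq, div_eq_iff (by positivity), add_mul, Finset.sum_mul]
  have hr' := hr.ne'
  congr 1
  · field_simp
    norm_num
    ring
  · refine Finset.sum_congr rfl fun i _ => ?_
    field_simp
    norm_num
    ring

lemma temperedFun_sqrt (hf : UnitFun f) (hs : 0 < s) :
    TemperedFun fun x =>
      Real.sqrt (Igauss (ou n s f x) ^ 2 + ‖gradient (ou n s f) x‖ ^ 2) := by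
  have hh := (hf.contDiff_gaussQuantile_ou hs).continuous
  have hp := fun i => continuous_pd (hf.tempered.contDiff_ou hs 1) i
  have hφ := (contDiff_gaussPdf (k := 0)).continuous
  simp only [sq_norm_gradient, Igauss_eq (hf.ou_mem_Ioo hs _)]
  have hb : PolyBdd (Set.Ici s) fun s x =>
      1 + (gaussPdf (gaussQuantile (ou n s f x)) * gaussPdf (gaussQuantile (ou n s f x))
        + ∑ i, pd i (ou n s f) x * pd i (ou n s f) x) := by
    have h1 : PolyBdd (Set.Ici s) fun s x => gaussPdf (gaussQuantile (ou n s f x)) :=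
      (PolyBdd.const 1).of_abs_le fun _ _ x => by
        rw [abs_of_pos (gaussPdf_pos _), abs_one]
        exact gaussPdf_le_one _
    exact (PolyBdd.const 1).add ((h1.mul h1).add (PolyBdd.sum fun i _ =>
      (hf.tempered.polyBdd_pd_ou hs i).mul (hf.tempered.polyBdd_pd_ou hs i)))
  simp only [← sq] at hb
  refine PolyBdd.temperedFun (S := Set.Ici s) (s := s) (w := fun s x => Real.sqrt
    (gaussPdf (gaussQuantile (ou n s f x)) ^ 2 + ∑ i, pd i (ou n s f) x ^ 2))
    (hb.of_abs_le fun t _ x => ?_) Set.self_mem_Ici (Continuous.measurable (by fun_prop))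
  have hA : 0 ≤ gaussPdf (gaussQuantile (ou n t f x)) ^ 2 + ∑ i, pd i (ou n t f) x ^ 2 := by
    positivity
  rw [abs_of_nonneg (Real.sqrt_nonneg _), abs_of_nonneg (by linarith), Real.sqrt_le_left
    (by linarith)]
  nlinarith

lemma hasDerivAt_bobkov (hf : UnitFun f) (hs : 0 < s) :
    HasDerivAt (fun s => ∫ x, Real.sqrt (Igauss (ou n s f x) ^ 2 + ‖gradient (ou n s f) x‖ ^ 2)
        ∂(gaussE n))
      (∫ x, bobkovDt (fun y => gaussQuantile (ou n s f y)) x ∂(gaussE n)) s := by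
  obtain ⟨C, k, hb⟩ := hf.polyBdd_bobkovDt (half_pos hs)
  have hpos : ∀ t ∈ Set.Ioi (s / 2), 0 < t := fun t ht => (half_pos hs).trans ht
  have hbound : ∀ x, ∀ t ∈ Set.Ioi (s / 2),
      ‖bobkovDt (fun y => gaussQuantile (ou n t f y)) x‖ ≤ C * (1 + ‖x‖) ^ k := fun x t ht => by
    rw [Real.norm_eq_abs]
    exact hb t (Set.Ioi_subset_Ici_self ht) x
  have hmeas : ∀ᶠ t in 𝓝 s, AEStronglyMeasurable (fun x => Real.sqrt (Igauss (ou n t f x) ^ 2 +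
      ‖gradient (ou n t f) x‖ ^ 2)) (gaussE n) :=
    (eventually_gt_nhds hs).mono fun t ht =>
      (hf.temperedFun_sqrt ht).measurable.aestronglyMeasurable
  have hmeas' : AEStronglyMeasurable (bobkovDt fun y => gaussQuantile (ou n s f y)) (gaussE n) :=
    (continuous_bobkovDt (hf.contDiff_gaussQuantile_ou hs)).aestronglyMeasurable
  exact (hasDerivAt_integral_of_dominated_loc_of_deriv_le (μ := gaussE n) (x₀ := s)
    (F := fun t x => Real.sqrt (Igauss (ou n t f x) ^ 2 + ‖gradient (ou n t f) x‖ ^ 2))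
    (F' := fun t x => bobkovDt (fun y => gaussQuantile (ou n t f y)) x)
    (bound := fun x => C * (1 + ‖x‖) ^ k) (Ioi_mem_nhds (half_lt_self hs)) hmeas
    (hf.temperedFun_sqrt hs).integrable_gaussE hmeas' (ae_of_all _ hbound)
    ((integrable_one_add_norm_pow k).const_mul C)
    (ae_of_all _ fun x t ht => hf.hasDerivAt_bobkovIntegrand (hpos t ht) x)).2

end UnitFun

end BobkovFunctional

/-- Derivative estimate for the Bakry–Ledoux functional along the
Ornstein–Uhlenbeck semigroup. -/
theorem bobkov_functional_derivative {n : ℕ} (f : En n → ℝ)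
    (hmeas : Measurable f) (h01 : ∀ x, f x ∈ Set.Icc (0 : ℝ) 1)
    (h0 : 0 < ∫ x, f x ∂(gaussE n)) (h1 : (∫ x, f x ∂(gaussE n)) < 1) :
    ∃ ψ' : ℝ → ℝ, ∀ s : ℝ, 0 < s →
      HasDerivAt
        (fun u : ℝ =>
          ∫ x, Real.sqrt ((Igauss (ou n u f x)) ^ 2 + ‖gradient (ou n u f) x‖ ^ 2)
            ∂(gaussE n))
        (ψ' s) s ∧
      -ψ' s ≥
        ∫ x,
          Igauss (ou n s f x) * hessHS2 n (fun y => gaussQuantile (ou n s f y)) x *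
            (1 + ‖gradient (fun y => gaussQuantile (ou n s f y)) x‖ ^ 2) ^ (-(3 : ℝ) / 2)
          ∂(gaussE n) := by
  have hf : UnitFun f := ⟨hmeas, h01, h0, h1⟩
  exact ⟨fun s => ∫ x, bobkovDt (fun y => gaussQuantile (ou n s f y)) x ∂(gaussE n),
    fun s hs => ⟨hf.hasDerivAt_bobkov hs, hf.integral_hessHS2_le hs⟩⟩
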